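/- arXiv:2304.04855 — 2 statements merged into one kernel-verified Lean document; each statement's English description precedes it below -/
import Mathlib

section
/- There exist a constant c > 0 and an integer q₀ such that for every integer q ≥ q₀ the following holds: every 3-uniform hypergraph on q² vertices whose edge set is the union of all 3-element subsets of a family of at most 2q² vertex sets of size q, any two of which share at most one vertex, has at least 2^{c · q^{1/2} · (log q)^{3/2}} independent sets. -/
open Finset

theorem exp_neg_mul_le_prod {ι : Type*} (s : Finset ι) (x : ι → ℝ) (L : ℝ)
    (h₁ : ∀ i ∈ s, 1 / 2 ≤ x i) (h₂ : ∀ i ∈ s, x i ≤ 1) :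
    Real.exp (-L) * (1 + L - 2 * ∑ i ∈ s, (1 - x i)) ≤ ∏ i ∈ s, x i := by
  have key : ∀ i ∈ s, Real.exp (-(2 * (1 - x i))) ≤ x i := by
    intro i hi
    have a := h₁ i hi
    have b := h₂ i hi
    rw [Real.exp_neg]
    have c := Real.add_one_le_exp (2 * (1 - x i))
    refine inv_le_of_inv_le₀ (by linarith) (le_trans ?_ c)
    rw [inv_le_iff_one_le_mul₀ (by linarith)]
    nlinarith
  calc Real.exp (-L) * (1 + L - 2 * ∑ i ∈ s, (1 - x i))
      ≤ Real.exp (-L) * Real.exp (L - 2 * ∑ i ∈ s, (1 - x i)) := by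
        gcongr
        linarith [Real.add_one_le_exp (L - 2 * ∑ i ∈ s, (1 - x i))]
    _ = ∏ i ∈ s, Real.exp (-(2 * (1 - x i))) := by
        rw [← Real.exp_add, ← Real.exp_sum, sum_neg_distrib, mul_sum]
        ring_nf
    _ ≤ ∏ i ∈ s, x i := prod_le_prod (fun i _ => (Real.exp_pos _).le) key

theorem sum_powerset_union {V M : Type*} [DecidableEq V] [AddCommMonoid M] {P Q : Finset V}
    (h : Disjoint P Q) (F : Finset V → M) :
    ∑ B ∈ (P ∪ Q).powerset, F B = ∑ C ∈ P.powerset, ∑ D ∈ Q.powerset, F (C ∪ D) := by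
  rw [← sum_product']
  have h' : ∀ a ∈ P, a ∉ Q := fun a ha hb => disjoint_left.1 h ha hb
  refine sum_nbij' (fun B => (B ∩ P, B ∩ Q)) (fun x => x.1 ∪ x.2) ?_ ?_ ?_ ?_ ?_
  · intro B _
    simp [inter_subset_right]
  · rintro ⟨C, D⟩ hx
    simp only [mem_product, mem_powerset] at hx ⊢
    exact union_subset_union hx.1 hx.2
  · intro B hB
    simp only [mem_powerset] at hB
    simp only [← inter_union_distrib_left]
    exact inter_eq_left.2 hB
  · rintro ⟨C, D⟩ hx
    simp only [mem_product, mem_powerset] at hx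
    obtain ⟨h1, h2⟩ := hx
    ext a <;> simp only [mem_inter, mem_union] <;> grind
  · intro B hB
    simp only [mem_powerset] at hB
    simp only [← inter_union_distrib_left, inter_eq_left.2 hB]

theorem sum_powerset_biUnion {ι V R : Type*} [DecidableEq ι] [DecidableEq V] [CommSemiring R]
    (S : Finset ι) (P : ι → Finset V) (hP : (S : Set ι).PairwiseDisjoint P)
    (φ : ι → Finset V → R) :
    ∑ B ∈ (S.biUnion P).powerset, ∏ i ∈ S, φ i (B ∩ P i) =
      ∏ i ∈ S, ∑ C ∈ (P i).powerset, φ i C := by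
  induction S using Finset.induction_on with
  | empty => simp
  | insert a S ha ih =>
    have hd : ∀ i ∈ S, Disjoint (P a) (P i) := fun i hi =>
      hP (by simp) (by simp [hi]) (by rintro rfl; exact ha hi)
    rw [biUnion_insert, sum_powerset_union ((disjoint_biUnion_right _ _ _).2 hd), prod_insert ha,
      ← ih (hP.subset (by simp)), sum_mul_sum]
    refine sum_congr rfl fun C hC => sum_congr rfl fun D hD => ?_
    rw [mem_powerset] at hC hD
    rw [prod_insert ha]
    congr 1
    · congr 1
      rw [union_inter_distrib_right, inter_eq_left.2 hC]
      have : Disjoint D (P a) :=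
        ((disjoint_biUnion_right _ _ _).2 hd).symm.mono_left hD
      rw [disjoint_iff_inter_eq_empty.1 this, union_empty]
    · refine prod_congr rfl fun i hi => ?_
      rw [union_inter_distrib_right, disjoint_iff_inter_eq_empty.1 ((hd i hi).mono_left hC),
        empty_union]

theorem tangent_le_sum_prod {ι V : Type*} [DecidableEq ι] [DecidableEq V]
    (S : Finset ι) (P : ι → Finset V) (hP : (S : Set ι).PairwiseDisjoint P)
    (φ f : ι → Finset V → ℝ) (L : ℝ) (hφ : ∀ i ∈ S, ∀ C, 0 ≤ φ i C)
    (hf : ∀ i ∈ S, ∀ C ⊆ P i, f i C ≤ 1)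
    (h : ∀ i ∈ S, ∑ C ∈ (P i).powerset, φ i C ≤ 2 * ∑ C ∈ (P i).powerset, φ i C * f i C) :
    Real.exp (-L) * ∑ B ∈ (S.biUnion P).powerset,
        (∏ i ∈ S, φ i (B ∩ P i)) * (1 + L - 2 * ∑ i ∈ S, (1 - f i (B ∩ P i))) ≤
      ∑ B ∈ (S.biUnion P).powerset, (∏ i ∈ S, φ i (B ∩ P i)) * ∏ i ∈ S, f i (B ∩ P i) := by
  set o : ι → ℝ := fun i => ∑ C ∈ (P i).powerset, φ i C with ho
  have hx : ∀ i ∈ S, ∃ x : ℝ, 1 / 2 ≤ x ∧ x ≤ 1 ∧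
      ∑ C ∈ (P i).powerset, φ i C * f i C = o i * x := by
    intro i hi
    have o0 : 0 ≤ o i := sum_nonneg fun C _ => hφ i hi C
    have le : ∑ C ∈ (P i).powerset, φ i C * f i C ≤ o i := sum_le_sum fun C hC =>
      mul_le_of_le_one_right (hφ i hi C) (hf i hi C (mem_powerset.1 hC))
    have ge := h i hi
    rcases o0.eq_or_lt with h0 | h0
    · refine ⟨1, by norm_num, le_rfl, ?_⟩
      simp only [ho] at *
      linarith
    · refine ⟨(∑ C ∈ (P i).powerset, φ i C * f i C) / o i, ?_, ?_, ?_⟩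
      · rw [le_div_iff₀ h0]
        simp only [ho] at *
        linarith
      · exact (div_le_one h0).2 le
      · field_simp
  choose! x hx₁ hx₂ hx₃ using hx
  have e₁ : ∑ B ∈ (S.biUnion P).powerset, (∏ i ∈ S, φ i (B ∩ P i)) * ∏ i ∈ S, f i (B ∩ P i) =
      (∏ i ∈ S, o i) * ∏ i ∈ S, x i := by
    simp only [← prod_mul_distrib]
    rw [sum_powerset_biUnion S P hP (fun i C => φ i C * f i C)]
    exact prod_congr rfl hx₃
  have e₂ : ∀ j ∈ S, ∑ B ∈ (S.biUnion P).powerset,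
      (∏ i ∈ S, φ i (B ∩ P i)) * (1 - f j (B ∩ P j)) = (∏ i ∈ S, o i) * (1 - x j) := by
    intro j hj
    have : ∀ B, (∏ i ∈ S, φ i (B ∩ P i)) * (1 - f j (B ∩ P j)) =
        ∏ i ∈ S, φ i (B ∩ P i) * (if i = j then 1 - f i (B ∩ P i) else 1) := by
      intro B
      rw [prod_mul_distrib, prod_ite_eq' S j, if_pos hj]
    simp only [this]
    rw [sum_powerset_biUnion S P hP (fun i C => φ i C * (if i = j then 1 - f i C else 1))]
    have : (∏ i ∈ S, o i) * (1 - x j) = ∏ i ∈ S, o i * (if i = j then 1 - x i else 1) := by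
      rw [prod_mul_distrib, prod_ite_eq' S j, if_pos hj]
    rw [this]
    refine prod_congr rfl fun i hi => ?_
    split_ifs with hij
    · simp only [mul_sub, mul_one, sum_sub_distrib, hx₃ i hi]
      rfl
    · simp only [mul_one]
      rfl
  have e₃ : ∑ B ∈ (S.biUnion P).powerset,
        (∏ i ∈ S, φ i (B ∩ P i)) * (1 + L - 2 * ∑ i ∈ S, (1 - f i (B ∩ P i))) =
      (∏ i ∈ S, o i) * (1 + L - 2 * ∑ i ∈ S, (1 - x i)) := by
    have : ∀ B, (∏ i ∈ S, φ i (B ∩ P i)) * (1 + L - 2 * ∑ i ∈ S, (1 - f i (B ∩ P i))) =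
        (∏ i ∈ S, φ i (B ∩ P i)) * (1 + L) -
          2 * ∑ j ∈ S, (∏ i ∈ S, φ i (B ∩ P i)) * (1 - f j (B ∩ P j)) := by
      intro B
      rw [← mul_sum]
      ring
    simp only [this]
    rw [sum_sub_distrib, ← sum_mul, sum_powerset_biUnion S P hP φ, ← mul_sum, sum_comm,
      sum_congr rfl e₂, ← mul_sum]
    ring
  rw [e₁, e₃]
  have := mul_le_mul_of_nonneg_left (exp_neg_mul_le_prod S x L hx₁ hx₂)
    (prod_nonneg fun i hi => sum_nonneg fun C _ => hφ i hi C : 0 ≤ ∏ i ∈ S, o i)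
  linarith

/-- A linear triangle-free 3-uniform hypergraph, given by its set of edges. -/
structure IsTriangleFreeTripleSystem {V : Type*} [DecidableEq V] (E : Finset (Finset V)) :
    Prop where
  card_eq : ∀ e ∈ E, e.card = 3
  card_inter_le : ∀ e ∈ E, ∀ f ∈ E, e ≠ f → (e ∩ f).card ≤ 1
  eq_of_triangle : ∀ v, ∀ e ∈ E, ∀ e' ∈ E, ∀ f ∈ E, v ∈ e → v ∈ e' → v ∉ f →
    (e ∩ f).Nonempty → (e' ∩ f).Nonempty → e = e'

/-- The factor contributed to the weight of a set by an edge meeting it in a given number of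
points. -/
def edgeFactor (θ : ℝ) : ℕ → ℝ
  | 0 => 1
  | 1 => 1
  | 2 => θ
  | _ => 0

/-- A weight on vertex sets that is supported on independent sets and discourages edges meeting
the set in two points. -/
def setWeight {V : Type*} [DecidableEq V] (θ : ℝ) (E : Finset (Finset V)) (W : Finset V) : ℝ :=
  ∏ e ∈ E, edgeFactor θ (e ∩ W).card

section edgeFactor

variable {θ : ℝ}

theorem edgeFactor_nonneg (h : 0 ≤ θ) (k : ℕ) : 0 ≤ edgeFactor θ k := by
  unfold edgeFactor
  split <;> simp [h]

theorem edgeFactor_le_one (h : θ ≤ 1) (k : ℕ) : edgeFactor θ k ≤ 1 := by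
  unfold edgeFactor
  split <;> simp [h]

theorem edgeFactor_antitone (h₀ : 0 ≤ θ) (h₁ : θ ≤ 1) : Antitone (edgeFactor θ) := by
  refine antitone_nat_of_succ_le fun k => ?_
  match k with
  | 0 => simp [edgeFactor]
  | 1 => simpa [edgeFactor] using h₁
  | 2 => simpa [edgeFactor] using h₀
  | k + 3 => simp [edgeFactor]

theorem edgeFactor_mul_succ {k : ℕ} (hk : k ≤ 2) :
    edgeFactor θ k * edgeFactor θ (k + 1) = edgeFactor θ (k + 1) := by
  interval_cases k <;> simp [edgeFactor]

end edgeFactor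

section weight

variable {V : Type*} [DecidableEq V] {θ : ℝ} {E : Finset (Finset V)}

theorem setWeight_nonneg (h : 0 ≤ θ) (W : Finset V) : 0 ≤ setWeight θ E W :=
  prod_nonneg fun _ _ => edgeFactor_nonneg h _

theorem setWeight_empty : setWeight θ E ∅ = 1 := by
  simp [setWeight, edgeFactor]

theorem setWeight_insert (hE : ∀ e ∈ E, e.card = 3) {v : V} {W : Finset V} (hv : v ∉ W) :
    setWeight θ E (insert v W) =
      setWeight θ E W * ∏ e ∈ E with v ∈ e, edgeFactor θ ((e ∩ W).card + 1) := by
  unfold setWeight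
  rw [prod_filter, ← prod_mul_distrib]
  refine prod_congr rfl fun e he => ?_
  split_ifs with h
  · have hv' : v ∉ e ∩ W := fun h' => hv (mem_inter.1 h').2
    rw [inter_insert_of_mem h, card_insert_of_notMem hv', edgeFactor_mul_succ]
    have : (e ∩ W).card < e.card := card_lt_card
      ⟨inter_subset_left, fun hs => hv' (hs h)⟩
    have := hE e he
    omega
  · rw [inter_insert_of_notMem h, mul_one]

theorem link_pairwiseDisjoint (hE : IsTriangleFreeTripleSystem E) (v : V) :
    ((E.filter (v ∈ ·) : Finset (Finset V)) : Set (Finset V)).PairwiseDisjoint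
      (fun e => e.erase v) := by
  intro e he f hf hne
  rw [mem_coe, mem_filter] at he hf
  refine disjoint_left.2 fun a ha hb => ?_
  rw [mem_erase] at ha hb
  have := card_le_one.1 (hE.card_inter_le e he.1 f hf.1 hne) a (mem_inter.2 ⟨ha.2, hb.2⟩) v
    (mem_inter.2 ⟨he.2, hf.2⟩)
  exact ha.1 this

/-- The part of the weight that an edge `e` through `v` accounts for: its own factor, and those
of the edges avoiding `v` that meet `e`. -/
def linkWeight (θ : ℝ) (E : Finset (Finset V)) (v : V) (U e C : Finset V) : ℝ :=
  edgeFactor θ C.card *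
    ∏ f ∈ E with v ∉ f ∧ (e ∩ f).Nonempty, edgeFactor θ (f ∩ (U ∪ C)).card

theorem linkWeight_nonneg (h₀ : 0 ≤ θ) (v : V) (U e C : Finset V) :
    0 ≤ linkWeight θ E v U e C :=
  mul_nonneg (edgeFactor_nonneg h₀ _) (prod_nonneg fun _ _ => edgeFactor_nonneg h₀ _)

theorem sum_linkWeight_le (h₀ : 1 / 2 ≤ θ) (h₁ : θ ≤ 1) (v : V) (U e : Finset V)
    (he : e.card = 3) (hv : v ∈ e) :
    ∑ C ∈ (e.erase v).powerset, linkWeight θ E v U e C ≤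
      2 * ∑ C ∈ (e.erase v).powerset, linkWeight θ E v U e C * edgeFactor θ (C.card + 1) := by
  have hθ : 0 ≤ θ := by linarith
  have hc : (e.erase v).card = 2 := by rw [card_erase_of_mem hv, he]
  obtain ⟨a, b, hab, hP⟩ := card_eq_two.1 hc
  have hle : linkWeight θ E v U e {a, b} ≤ linkWeight θ E v U e ∅ := by
    unfold linkWeight
    refine mul_le_mul ?_ ?_ (prod_nonneg fun _ _ => edgeFactor_nonneg hθ _)
      (edgeFactor_nonneg hθ _)
    · exact edgeFactor_antitone hθ h₁ (by simp)
    · refine prod_le_prod (fun _ _ => edgeFactor_nonneg hθ _) fun f _ => ?_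
      refine edgeFactor_antitone hθ h₁ (card_le_card ?_)
      gcongr
      simp
  have ha := linkWeight_nonneg (E := E) hθ v U e {a}
  have hb := linkWeight_nonneg (E := E) hθ v U e {b}
  have hab' : ({a} : Finset V) ≠ {b} := by simpa using hab
  have expand : ∀ F : Finset V → ℝ, ∑ C ∈ (e.erase v).powerset, F C =
      F ∅ + F {a} + F {b} + F {a, b} := by
    intro F
    have h1 : ∀ G : Finset V → ℝ, ∑ C ∈ ({b} : Finset V).powerset, G C = G ∅ + G {b} := by
      intro G
      rw [← insert_empty_eq b, sum_powerset_insert (by simp)]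
      simp
    rw [hP, sum_powerset_insert (by simpa using hab), h1, h1, insert_empty_eq]
    ring
  rw [expand, expand]
  simp only [card_empty, card_singleton, card_pair hab, edgeFactor]
  nlinarith

theorem inter_union_card_of_mem {v : V} {U B : Finset V}
    (hU : Disjoint U ((E.filter (v ∈ ·)).biUnion fun e => e.erase v)) (hvU : v ∉ U)
    (hB : B ⊆ (E.filter (v ∈ ·)).biUnion fun e => e.erase v) {e : Finset V} (he : e ∈ E)
    (hv : v ∈ e) : (e ∩ (U ∪ B)).card = (B ∩ e.erase v).card := by
  congr 1
  have hvB : v ∉ B := fun h => by simpa using hB h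
  ext a
  simp only [mem_inter, mem_union, mem_erase]
  constructor
  · rintro ⟨h1, h2 | h2⟩
    · have hav : a ≠ v := by rintro rfl; exact hvU h2
      exact (disjoint_left.1 hU h2
        (mem_biUnion.2 ⟨e, mem_filter.2 ⟨he, hv⟩, mem_erase.2 ⟨hav, h1⟩⟩)).elim
    · exact ⟨h2, by rintro rfl; exact hvB h2, h1⟩
  · rintro ⟨h1, h2, h3⟩
    exact ⟨h3, Or.inr h1⟩

/-- If `U` avoids all edges through `v`, then the weight of `U ∪ B` factors over the edges
through `v`. -/
theorem setWeight_union_eq (hE : IsTriangleFreeTripleSystem E) {v : V} {U B : Finset V}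
    (hU : Disjoint U ((E.filter (v ∈ ·)).biUnion fun e => e.erase v)) (hvU : v ∉ U)
    (hB : B ⊆ (E.filter (v ∈ ·)).biUnion fun e => e.erase v) :
    setWeight θ E (U ∪ B) =
      (∏ f ∈ E with v ∉ f ∧ ∀ e ∈ E, v ∈ e → ¬ (e ∩ f).Nonempty, edgeFactor θ (f ∩ U).card) *
        ∏ e ∈ E with v ∈ e, linkWeight θ E v U e (B ∩ e.erase v) := by
  have hfac : ∀ e ∈ E, v ∈ e → ∀ f ∈ E, v ∉ f → (e ∩ f).Nonempty →
      f ∩ (U ∪ B) = f ∩ (U ∪ B ∩ e.erase v) := by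
    intro e he hv f hf hvf hef
    refine Subset.antisymm (fun x hx => ?_) (by gcongr; exact inter_subset_left)
    obtain ⟨hxf, hx⟩ := mem_inter.1 hx
    refine mem_inter.2 ⟨hxf, ?_⟩
    rcases mem_union.1 hx with hx | hx
    · exact mem_union_left _ hx
    · obtain ⟨e', he', hxe'⟩ := mem_biUnion.1 (hB hx)
      obtain ⟨he'E, hve'⟩ := mem_filter.1 he'
      have := hE.eq_of_triangle v e he e' he'E f hf hv hve' hvf hef
        ⟨x, mem_inter.2 ⟨(mem_erase.1 hxe').2, hxf⟩⟩
      subst this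
      exact mem_union_right _ (mem_inter.2 ⟨hx, hxe'⟩)
  have hfar : ∀ f ∈ E, v ∉ f → (∀ e ∈ E, v ∈ e → ¬ (e ∩ f).Nonempty) →
      f ∩ (U ∪ B) = f ∩ U := by
    intro f hf hvf hef
    refine Subset.antisymm (fun x hx => ?_) (by gcongr; exact subset_union_left)
    obtain ⟨hxf, hx⟩ := mem_inter.1 hx
    refine mem_inter.2 ⟨hxf, ?_⟩
    rcases mem_union.1 hx with hx | hx
    · exact hx
    · obtain ⟨e, he, hxe⟩ := mem_biUnion.1 (hB hx)
      obtain ⟨heE, hve⟩ := mem_filter.1 he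
      exact (hef e heE hve ⟨x, mem_inter.2 ⟨(mem_erase.1 hxe).2, hxf⟩⟩).elim
  have hnear : (E.filter (v ∉ ·)).filter
        (fun f => ¬ ∀ e ∈ E, v ∈ e → ¬ (e ∩ f).Nonempty) =
      (E.filter (v ∈ ·)).biUnion
        fun e => E.filter fun f => v ∉ f ∧ (e ∩ f).Nonempty := by
    ext f
    simp only [mem_filter, mem_biUnion]
    push Not
    constructor
    · rintro ⟨⟨hf, hvf⟩, e, he, hve, h⟩
      exact ⟨e, ⟨he, hve⟩, hf, hvf, h⟩
    · rintro ⟨e, ⟨he, hve⟩, hf, hvf, h⟩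
      exact ⟨⟨hf, hvf⟩, e, he, hve, h⟩
  have hdisj : ((E.filter (v ∈ ·) : Finset (Finset V)) : Set (Finset V)).PairwiseDisjoint
      fun e => E.filter fun f => v ∉ f ∧ (e ∩ f).Nonempty := by
    intro e he e' he' hne
    rw [mem_coe, mem_filter] at he he'
    refine disjoint_left.2 fun f hf hf' => ?_
    rw [mem_filter] at hf hf'
    exact hne (hE.eq_of_triangle v e he.1 e' he'.1 f hf.1 he.2 he'.2 hf.2.1 hf.2.2 hf'.2.2)
  unfold setWeight linkWeight
  rw [prod_mul_distrib, ← prod_filter_mul_prod_filter_not E (v ∈ ·),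
    ← prod_filter_mul_prod_filter_not (E.filter (v ∉ ·))
      (fun f => ∀ e ∈ E, v ∈ e → ¬ (e ∩ f).Nonempty), hnear, prod_biUnion hdisj, filter_filter,
    mul_left_comm]
  congr 1
  · refine prod_congr rfl fun f hf => ?_
    obtain ⟨hf, hvf, h⟩ := mem_filter.1 hf
    rw [hfar f hf hvf h]
  congr 1
  · refine prod_congr rfl fun e he => ?_
    rw [inter_union_card_of_mem hU hvU hB (mem_filter.1 he).1 (mem_filter.1 he).2]
  · refine prod_congr rfl fun e he => prod_congr rfl fun f hf => ?_
    obtain ⟨hf, hvf, h⟩ := mem_filter.1 hf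
    rw [hfac e (mem_filter.1 he).1 (mem_filter.1 he).2 f hf hvf h]


theorem tangent_le_sum_setWeight_insert (hE : IsTriangleFreeTripleSystem E) (h₀ : 1 / 2 ≤ θ)
    (h₁ : θ ≤ 1) {X : Finset V} (hX : ∀ e ∈ E, e ⊆ X) (v : V) (L : ℝ) :
    Real.exp (-L) * ∑ W ∈ (X.erase v).powerset, setWeight θ E W *
        (1 + L - 2 * ∑ e ∈ E with v ∈ e, (1 - edgeFactor θ ((e ∩ W).card + 1))) ≤
      ∑ W ∈ (X.erase v).powerset, setWeight θ E (insert v W) := by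
  have hθ : 0 ≤ θ := by linarith
  set S := E.filter (v ∈ ·) with hS
  set N := S.biUnion fun e => e.erase v with hN
  have hNX : N ⊆ X.erase v := by
    refine biUnion_subset.2 fun e he => erase_subset_erase _ (hX e (mem_filter.1 he).1)
  have hins : ∑ W ∈ (X.erase v).powerset, setWeight θ E (insert v W) =
      ∑ W ∈ (X.erase v).powerset,
        setWeight θ E W * ∏ e ∈ S, edgeFactor θ ((e ∩ W).card + 1) := by
    refine sum_congr rfl fun W hW => setWeight_insert hE.card_eq fun hv => ?_
    simpa using mem_powerset.1 hW hv
  rw [hins, ← sdiff_union_of_subset hNX, sum_powerset_union sdiff_disjoint,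
    sum_powerset_union sdiff_disjoint, mul_sum]
  refine sum_le_sum fun U hU => ?_
  have hU' := mem_powerset.1 hU
  have hUN : Disjoint U N := sdiff_disjoint.mono_left hU'
  have hvU : v ∉ U := fun h => by simpa using (mem_sdiff.1 (hU' h)).1
  set A := ∏ f ∈ E with v ∉ f ∧ ∀ e ∈ E, v ∈ e → ¬ (e ∩ f).Nonempty, edgeFactor θ (f ∩ U).card
  have hA : 0 ≤ A := prod_nonneg fun _ _ => edgeFactor_nonneg hθ _
  have key := mul_le_mul_of_nonneg_left (tangent_le_sum_prod S (fun e => e.erase v)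
    (link_pairwiseDisjoint hE v) (linkWeight θ E v U) (fun _ C => edgeFactor θ (C.card + 1)) L
    (fun e _ C => linkWeight_nonneg hθ v U e C) (fun e _ C _ => edgeFactor_le_one h₁ _)
    (fun e he => sum_linkWeight_le h₀ h₁ v U e (hE.card_eq e (mem_filter.1 he).1)
      (mem_filter.1 he).2)) hA
  convert key using 1
  · rw [mul_left_comm, mul_sum _ _ A]
    congr 1
    refine sum_congr rfl fun B hB => ?_
    rw [mem_powerset] at hB
    rw [setWeight_union_eq hE hUN hvU hB, ← mul_assoc]
    congr 3
    refine sum_congr rfl fun e he => ?_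
    rw [inter_union_card_of_mem hUN hvU hB (mem_filter.1 he).1 (mem_filter.1 he).2]
  · rw [mul_sum]
    refine sum_congr rfl fun B hB => ?_
    rw [mem_powerset] at hB
    rw [setWeight_union_eq hE hUN hvU hB, ← mul_assoc]
    congr 1
    refine prod_congr rfl fun e he => ?_
    rw [inter_union_card_of_mem hUN hvU hB (mem_filter.1 he).1 (mem_filter.1 he).2]

end weight

section average

variable {V : Type*} [DecidableEq V] {θ : ℝ} {E : Finset (Finset V)}

theorem sum_powerset_erase {M : Type*} [AddCommMonoid M] (X : Finset V)
    (F : V → Finset V → M) :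
    ∑ v ∈ X, ∑ W ∈ (X.erase v).powerset, F v W = ∑ W ∈ X.powerset, ∑ v ∈ X \ W, F v W := by
  refine sum_comm' fun v W => ?_
  simp only [mem_powerset, mem_sdiff, subset_erase]
  tauto

theorem sum_powerset_erase_insert {M : Type*} [AddCommMonoid M] (X : Finset V)
    (F : V → Finset V → M) :
    ∑ v ∈ X, ∑ W ∈ (X.erase v).powerset, F v (insert v W) =
      ∑ W ∈ X.powerset, ∑ v ∈ W, F v W := by
  have h : ∀ v ∈ X, ∑ W ∈ (X.erase v).powerset, F v (insert v W) =
      ∑ W ∈ X.powerset with v ∈ W, F v W := by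
    intro v hv
    refine sum_nbij' (insert v) (fun W => W.erase v) ?_ ?_ ?_ ?_ ?_
    · intro W hW
      rw [mem_powerset, subset_erase] at hW
      simp [insert_subset_iff, hv, hW.1]
    · intro W hW
      rw [mem_filter, mem_powerset] at hW
      exact mem_powerset.2 (erase_subset_erase _ hW.1)
    · intro W hW
      rw [mem_powerset, subset_erase] at hW
      exact erase_insert hW.2
    · intro W hW
      exact insert_erase (mem_filter.1 hW).2
    · intros
      rfl
  rw [sum_congr rfl h]
  refine sum_comm' fun v W => ?_
  simp only [mem_filter, mem_powerset]
  exact ⟨fun h => ⟨h.2.2, h.2.1⟩, fun h => ⟨h.2 h.1, h.2, h.1⟩⟩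

theorem sum_card_inter_le_mul {D : ℝ} (hD : ∀ v, ((E.filter (v ∈ ·)).card : ℝ) ≤ D)
    (W : Finset V) : ∑ e ∈ E, ((e ∩ W).card : ℝ) ≤ D * W.card := by
  calc ∑ e ∈ E, ((e ∩ W).card : ℝ) = ∑ e ∈ E, ∑ w ∈ W, if w ∈ e then (1 : ℝ) else 0 := by
        refine sum_congr rfl fun e _ => ?_
        rw [← sum_filter, sum_const, nsmul_eq_mul, mul_one, filter_mem_eq_inter, inter_comm]
    _ = ∑ w ∈ W, ((E.filter (w ∈ ·)).card : ℝ) := by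
        rw [sum_comm]
        simp
    _ ≤ ∑ _w ∈ W, D := sum_le_sum fun w _ => hD w
    _ = D * W.card := by simp [mul_comm]

theorem sum_sdiff_le (hE : ∀ e ∈ E, e.card = 3) (h₁ : θ ≤ 1) {X W : Finset V}
    {D : ℝ} (hD : ∀ v, ((E.filter (v ∈ ·)).card : ℝ) ≤ D) :
    ∑ v ∈ X \ W, ∑ e ∈ E with v ∈ e, (1 - edgeFactor θ ((e ∩ W).card + 1)) ≤
      2 * (1 - θ) * (D * W.card) + (E.filter fun e => (e ∩ W).card = 2).card := by
  calc ∑ v ∈ X \ W, ∑ e ∈ E with v ∈ e, (1 - edgeFactor θ ((e ∩ W).card + 1))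
      = ∑ e ∈ E, ((e ∩ (X \ W)).card : ℝ) * (1 - edgeFactor θ ((e ∩ W).card + 1)) := by
        simp only [sum_filter]
        rw [sum_comm]
        refine sum_congr rfl fun e _ => ?_
        rw [← sum_filter, sum_const, nsmul_eq_mul, filter_mem_eq_inter, inter_comm]
    _ ≤ ∑ e ∈ E, (2 * (1 - θ) * ((e ∩ W).card : ℝ) +
          if (e ∩ W).card = 2 then (1 : ℝ) else 0) := by
        refine sum_le_sum fun e he => ?_
        have hle : (e ∩ (X \ W)).card + (e ∩ W).card ≤ 3 := by
          rw [← hE e he, ← card_union_of_disjoint]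
          · exact card_le_card (union_subset inter_subset_left inter_subset_left)
          · exact sdiff_disjoint.mono inter_subset_right inter_subset_right
        generalize (e ∩ (X \ W)).card = j at *
        generalize (e ∩ W).card = k at *
        have hk : k ≤ 3 := by omega
        have hj : (j : ℝ) + k ≤ 3 := by exact_mod_cast hle
        interval_cases k <;> norm_num [edgeFactor] at hj ⊢
        all_goals first | nlinarith | (rw [hj]; push_cast; linarith)
    _ ≤ _ := by
        rw [sum_add_distrib, ← mul_sum]
        have := sum_card_inter_le_mul hD W
        have h2 : 0 ≤ 2 * (1 - θ) := by linarith
        simp only [sum_boole]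
        gcongr

theorem sum_setWeight_mul_pairs_le (hE : ∀ e ∈ E, e.card = 3) (h₀ : 0 ≤ θ) (h₁ : θ ≤ 1)
    {X : Finset V} {D K : ℝ} (hD : ∀ v, ((E.filter (v ∈ ·)).card : ℝ) ≤ D)
    (hK₀ : 0 ≤ K) (hK : D * Real.exp (-((1 - θ) * K)) ≤ 1) :
    ∑ W ∈ X.powerset, setWeight θ E W * (2 * (E.filter fun e => (e ∩ W).card = 2).card) ≤
      K * ∑ W ∈ X.powerset, setWeight θ E W * W.card +
        X.card * ∑ W ∈ X.powerset, setWeight θ E W := by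
  have hpair : ∀ W : Finset V, (2 * (E.filter fun e => (e ∩ W).card = 2).card : ℝ) =
      ∑ w ∈ W, (((E.filter (w ∈ ·)).filter fun e => (e ∩ W).card = 2).card : ℝ) := by
    intro W
    have := sum_card_bipartiteAbove_eq_sum_card_bipartiteBelow
      (s := W) (t := E.filter fun e => (e ∩ W).card = 2) (fun w e => w ∈ e)
    have h2 : ∀ e ∈ E.filter fun e => (e ∩ W).card = 2,
        (W.bipartiteBelow (fun w e => w ∈ e) e).card = 2 := by
      intro e he
      rw [← (mem_filter.1 he).2, bipartiteBelow, filter_mem_eq_inter, inter_comm]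
    rw [sum_congr rfl h2, sum_const, smul_eq_mul, mul_comm] at this
    simp only [bipartiteAbove] at this
    have h3 : ∀ w : V, ((E.filter (w ∈ ·)).filter fun e => (e ∩ W).card = 2) =
        (E.filter fun e => (e ∩ W).card = 2).filter (w ∈ ·) := fun w => filter_comm _ _ _
    simp only [h3]
    exact_mod_cast this.symm
  have hterm : ∀ w : V, ∀ W ∈ (X.erase w).powerset, setWeight θ E (insert w W) *
      (((E.filter (w ∈ ·)).filter fun e => (e ∩ insert w W).card = 2).card : ℝ) ≤
      K * setWeight θ E (insert w W) + setWeight θ E W := by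
    intro w W hW
    rw [mem_powerset, subset_erase] at hW
    set s := ((E.filter (w ∈ ·)).filter fun e => (e ∩ insert w W).card = 2) with hs
    have n1 := setWeight_nonneg (E := E) h₀ (insert w W)
    have n2 := setWeight_nonneg (E := E) h₀ W
    rcases le_total (s.card : ℝ) K with h | h
    · nlinarith
    have hsD : (s.card : ℝ) ≤ D := le_trans (by exact_mod_cast card_filter_le _ _) (hD w)
    have hle : setWeight θ E (insert w W) ≤ setWeight θ E W * Real.exp (-((1 - θ) * K)) := by
      rw [setWeight_insert hE hW.2]
      refine mul_le_mul_of_nonneg_left ?_ n2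
      calc ∏ e ∈ E with w ∈ e, edgeFactor θ ((e ∩ W).card + 1)
          ≤ ∏ e ∈ s, edgeFactor θ ((e ∩ W).card + 1) := by
            rw [← prod_sdiff (filter_subset _ _ : s ⊆ _)]
            exact mul_le_of_le_one_left (prod_nonneg fun _ _ => edgeFactor_nonneg h₀ _)
              (prod_le_one (fun _ _ => edgeFactor_nonneg h₀ _) fun _ _ => edgeFactor_le_one h₁ _)
        _ = ∏ e ∈ s, θ := by
            refine prod_congr rfl fun e he => ?_
            obtain ⟨he, h2⟩ := mem_filter.1 he
            rw [inter_insert_of_mem (mem_filter.1 he).2, card_insert_of_notMem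
              (fun h => hW.2 (mem_inter.1 h).2)] at h2
            rw [h2, edgeFactor]
        _ ≤ ∏ e ∈ s, Real.exp (-(1 - θ)) := by
            refine prod_le_prod (fun _ _ => h₀) fun _ _ => ?_
            linarith [Real.add_one_le_exp (-(1 - θ))]
        _ = Real.exp (-((1 - θ) * s.card)) := by
            rw [prod_const, ← Real.exp_nat_mul]
            ring_nf
        _ ≤ Real.exp (-((1 - θ) * K)) := by
            have : 0 ≤ 1 - θ := by linarith
            gcongr
    calc setWeight θ E (insert w W) * (s.card : ℝ)
        ≤ (setWeight θ E W * Real.exp (-((1 - θ) * K))) * D := by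
          gcongr
      _ = setWeight θ E W * (D * Real.exp (-((1 - θ) * K))) := by ring
      _ ≤ setWeight θ E W * 1 := by gcongr
      _ ≤ _ := by nlinarith
  simp only [hpair, mul_sum]
  rw [← sum_powerset_erase_insert X (fun w W => setWeight θ E W *
    (((E.filter (w ∈ ·)).filter fun e => (e ∩ W).card = 2).card : ℝ))]
  refine (sum_le_sum fun w _ => sum_le_sum (hterm w)).trans ?_
  simp only [sum_add_distrib]
  rw [sum_powerset_erase_insert X (fun w W => K * setWeight θ E W)]
  refine add_le_add (le_of_eq ?_) ?_
  · refine sum_congr rfl fun W _ => ?_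
    rw [sum_const, nsmul_eq_mul]
    ring
  · rw [← mul_sum, ← nsmul_eq_mul, ← sum_const]
    refine sum_le_sum fun w _ => sum_le_sum_of_subset_of_nonneg
      (powerset_mono.2 (erase_subset _ _)) fun W _ _ => setWeight_nonneg h₀ W

theorem mul_card_mul_le_sum_setWeight (hE : IsTriangleFreeTripleSystem E) (h₀ : 1 / 2 ≤ θ)
    (h₁ : θ ≤ 1) {X : Finset V} (hX : ∀ e ∈ E, e ⊆ X) {D K : ℝ}
    (hD : ∀ v, ((E.filter (v ∈ ·)).card : ℝ) ≤ D) (hK₀ : 0 ≤ K)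
    (hK : D * Real.exp (-((1 - θ) * K)) ≤ 1) (L : ℝ) :
    Real.exp (-L) * (L * X.card) * ∑ W ∈ X.powerset, setWeight θ E W ≤
      (1 + Real.exp (-L) * (1 + L + 4 * (1 - θ) * D + K)) *
        ∑ W ∈ X.powerset, setWeight θ E W * W.card := by
  have hθ : 0 ≤ θ := by linarith
  have s₁ := sum_le_sum fun v (_ : v ∈ X) => tangent_le_sum_setWeight_insert hE h₀ h₁ hX v L
  rw [← mul_sum, sum_powerset_erase, sum_powerset_erase_insert X (fun _ W => setWeight θ E W)]
    at s₁
  have s₂ := sum_setWeight_mul_pairs_le (X := X) hE.card_eq hθ h₁ hD hK₀ hK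
  have s₃ : ∀ W ∈ X.powerset, setWeight θ E W * ((1 + L) * (X.card - W.card) -
        4 * (1 - θ) * D * W.card - 2 * (E.filter fun e => (e ∩ W).card = 2).card) ≤
      ∑ v ∈ X \ W, setWeight θ E W *
        (1 + L - 2 * ∑ e ∈ E with v ∈ e, (1 - edgeFactor θ ((e ∩ W).card + 1))) := by
    intro W hW
    rw [← mul_sum, sum_sub_distrib, sum_const, nsmul_eq_mul, ← mul_sum,
      card_sdiff_of_subset (mem_powerset.1 hW), Nat.cast_sub (card_le_card (mem_powerset.1 hW))]
    refine mul_le_mul_of_nonneg_left ?_ (setWeight_nonneg hθ W)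
    have := sum_sdiff_le (X := X) (W := W) hE.card_eq h₁ hD
    linarith
  have s₄ := sum_le_sum s₃
  have s₅ : ∑ W ∈ X.powerset, setWeight θ E W * ((1 + L) * (X.card - W.card) -
        4 * (1 - θ) * D * W.card - 2 * (E.filter fun e => (e ∩ W).card = 2).card) =
      (1 + L) * X.card * ∑ W ∈ X.powerset, setWeight θ E W -
        (1 + L + 4 * (1 - θ) * D) * ∑ W ∈ X.powerset, setWeight θ E W * W.card -
        ∑ W ∈ X.powerset,
          setWeight θ E W * (2 * (E.filter fun e => (e ∩ W).card = 2).card) := by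
    rw [mul_sum, mul_sum, ← sum_sub_distrib, ← sum_sub_distrib]
    exact sum_congr rfl fun W _ => by ring
  have s₆ : ∑ W ∈ X.powerset, ∑ _v ∈ W, setWeight θ E W =
      ∑ W ∈ X.powerset, setWeight θ E W * W.card :=
    sum_congr rfl fun W _ => by rw [sum_const, nsmul_eq_mul, mul_comm]
  rw [s₆] at s₁
  rw [s₅] at s₄
  set Z := ∑ W ∈ X.powerset, setWeight θ E W
  set M := ∑ W ∈ X.powerset, setWeight θ E W * W.card
  have s₇ := (mul_le_mul_of_nonneg_left (a := Real.exp (-L))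
    (b := (1 + L) * X.card * Z - (1 + L + 4 * (1 - θ) * D) * M - (K * M + X.card * Z))
    (by linarith) (Real.exp_pos _).le).trans s₁
  linarith

/-- A linear triangle-free 3-uniform hypergraph on `N` vertices with maximum degree at most `D`
has an independent set of size of order `N √(log D / D)`. -/
theorem exists_large_independent (hE : IsTriangleFreeTripleSystem E) {X : Finset V}
    (hX : ∀ e ∈ E, e ⊆ X) {D : ℝ} (hD₀ : 64 ≤ D)
    (hD : ∀ v, ((E.filter (v ∈ ·)).card : ℝ) ≤ D) :
    ∃ W ⊆ X, (∀ e ∈ E, ¬ e ⊆ W) ∧ √(Real.log D) / (16 * √D) * X.card ≤ W.card := by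
  set a := √D with ha
  set b := √(Real.log D) with hb
  have haa : a * a = D := Real.mul_self_sqrt (by linarith)
  have ha8 : 8 ≤ a := Real.le_sqrt_of_sq_le (by linarith)
  have hl1 : 1 ≤ Real.log D := by
    rw [Real.le_log_iff_exp_le (by linarith)]
    linarith [Real.exp_one_lt_d9]
  have hbb : b * b = Real.log D := Real.mul_self_sqrt (by linarith)
  have hb1 : 1 ≤ b := Real.one_le_sqrt.2 hl1
  have hlog : Real.log D ≤ 2 * a := by
    rw [← haa, Real.log_mul (by linarith) (by linarith)]
    linarith [Real.log_le_self (show 0 ≤ a by linarith)]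
  have hba : b / a ≤ 1 / 2 := by
    rw [div_le_iff₀ (by linarith)]
    nlinarith
  have hba0 : 0 ≤ b / a := by positivity
  have hexp : Real.exp (-(b * b / 2)) = 1 / a := by
    have : Real.exp (b * b / 2) = a := by
      rw [hbb, ← haa, Real.log_mul (by linarith) (by linarith), add_self_div_two,
        Real.exp_log (by linarith)]
    rw [Real.exp_neg, this, one_div]
  have key := mul_card_mul_le_sum_setWeight (θ := 1 - b / a) hE (by linarith) (by linarith) hX hD
    (K := a * b) (by positivity) (by
      have : (1 - (1 - b / a)) * (a * b) = Real.log D := by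
        rw [← hbb]
        field_simp
        ring
      rw [this, Real.exp_neg, Real.exp_log (by linarith), mul_inv_cancel₀ (by linarith)])
    (b * b / 2)
  rw [hexp] at key
  have hpos : 0 < ∑ W ∈ X.powerset, setWeight (1 - b / a) E W := by
    refine sum_pos' (fun W _ => setWeight_nonneg (by linarith) W)
      ⟨∅, empty_mem_powerset X, by rw [setWeight_empty]; exact one_pos⟩
  have hco : 1 + 1 / a * (1 + b * b / 2 + 4 * (1 - (1 - b / a)) * D + a * b) ≤ 8 * b := by
    have : 1 / a * (1 + b * b / 2 + 4 * (1 - (1 - b / a)) * D + a * b) =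
        1 / a + b * (b / a) / 2 + 5 * b := by
      rw [← haa]
      field_simp
      ring
    have h1 : 1 / a ≤ 1 := by
      rw [div_le_one (by linarith)]
      linarith
    nlinarith
  by_contra! hcon
  have hlt : ∑ W ∈ X.powerset, setWeight (1 - b / a) E W * W.card <
      ∑ W ∈ X.powerset, setWeight (1 - b / a) E W * (b / (16 * a) * X.card) := by
    have hW : ∀ W ∈ X.powerset, (∀ e ∈ E, ¬ e ⊆ W) ∨ setWeight (1 - b / a) E W = 0 := by
      intro W _
      by_cases h : ∀ e ∈ E, ¬ e ⊆ W
      · exact Or.inl h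
      · push Not at h
        obtain ⟨e, he, heW⟩ := h
        refine Or.inr (prod_eq_zero he ?_)
        rw [inter_eq_left.2 heW, hE.card_eq e he, edgeFactor]
        all_goals simp
    refine sum_lt_sum (fun W hWX => ?_) ⟨∅, empty_mem_powerset X, ?_⟩
    · rcases hW W hWX with h | h
      · exact mul_le_mul_of_nonneg_left (hcon W (mem_powerset.1 hWX) h).le
          (setWeight_nonneg (by linarith) W)
      · simp [h]
    · rw [setWeight_empty, one_mul, one_mul]
      refine hcon ∅ (empty_subset _) fun e he h => ?_
      have := hE.card_eq e he
      rw [subset_empty.1 h] at this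
      simp at this
  rw [← sum_mul] at hlt
  have hM : 0 ≤ ∑ W ∈ X.powerset, setWeight (1 - b / a) E W * W.card :=
    sum_nonneg fun W _ => mul_nonneg (setWeight_nonneg (by linarith) W) (by positivity)
  have k1 := key.trans (mul_le_mul_of_nonneg_right hco hM)
  have k2 := mul_lt_mul_of_pos_left hlt (show 0 < 8 * b by linarith)
  have k3 : 8 * b * ((∑ W ∈ X.powerset, setWeight (1 - b / a) E W) * (b / (16 * a) * X.card)) =
      1 / a * (b * b / 2 * X.card) * ∑ W ∈ X.powerset, setWeight (1 - b / a) E W := by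
    field_simp
    ring
  linarith

end average

section sampling

variable {V : Type*} [DecidableEq V]

/-- The `k`-element subsets of the members of a set family. -/
def subsetsOfCard (𝒜 : Finset (Finset V)) (k : ℕ) : Finset (Finset V) :=
  𝒜.biUnion (powersetCard k)

theorem mem_subsetsOfCard {𝒜 : Finset (Finset V)} {k : ℕ} {S : Finset V} :
    S ∈ subsetsOfCard 𝒜 k ↔ ∃ A ∈ 𝒜, S ⊆ A ∧ S.card = k := by
  simp [subsetsOfCard, mem_powersetCard]

theorem card_subsetsOfCard_le {𝒜 : Finset (Finset V)} {q : ℕ} (h : ∀ A ∈ 𝒜, A.card = q)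
    (k : ℕ) : (subsetsOfCard 𝒜 k).card ≤ 𝒜.card * q ^ k := by
  refine card_biUnion_le_card_mul _ _ _ fun A hA => ?_
  rw [card_powersetCard, h A hA]
  exact Nat.choose_le_pow _ _

/-- The union of the members of a set family containing two given distinct points. -/
def block (𝒜 : Finset (Finset V)) (a b : V) : Finset V :=
  (𝒜.filter fun A => a ≠ b ∧ a ∈ A ∧ b ∈ A).biUnion id

theorem mem_block {𝒜 : Finset (Finset V)} {a b x : V} {A : Finset V} (hA : A ∈ 𝒜) (hab : a ≠ b)
    (ha : a ∈ A) (hb : b ∈ A) (hx : x ∈ A) : x ∈ block 𝒜 a b :=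
  mem_biUnion.2 ⟨A, mem_filter.2 ⟨hA, hab, ha, hb⟩, hx⟩

theorem card_block_le {𝒜 : Finset (Finset V)} {q : ℕ} (h : ∀ A ∈ 𝒜, A.card = q)
    (h𝒜 : ∀ A ∈ 𝒜, ∀ B ∈ 𝒜, A ≠ B → (A ∩ B).card ≤ 1) (a b : V) :
    (block 𝒜 a b).card ≤ q := by
  have h1 : (𝒜.filter fun A => a ≠ b ∧ a ∈ A ∧ b ∈ A).card ≤ 1 := by
    refine card_le_one.2 fun A hA B hB => ?_
    obtain ⟨hA, hab, haA, hbA⟩ := mem_filter.1 hA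
    obtain ⟨hB, -, haB, hbB⟩ := mem_filter.1 hB
    by_contra hne
    exact hab (card_le_one.1 (h𝒜 A hA B hB hne) a (mem_inter.2 ⟨haA, haB⟩) b
      (mem_inter.2 ⟨hbA, hbB⟩))
  calc (block 𝒜 a b).card ≤ (𝒜.filter fun A => a ≠ b ∧ a ∈ A ∧ b ∈ A).card * q :=
        card_biUnion_le_card_mul _ _ _ fun A hA => (h A (mem_filter.1 hA).1).le
    _ ≤ 1 * q := by gcongr
    _ = q := one_mul q

/-- The six-point sets consisting of three points together with one further point in the block of
each pair of them. -/
def hexads [Fintype V] (𝒜 : Finset (Finset V)) : Finset (Finset V) :=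
  ((univ : Finset (V × V × V)).biUnion fun t =>
    (block 𝒜 t.1 t.2.1 ×ˢ block 𝒜 t.2.1 t.2.2 ×ˢ block 𝒜 t.2.2 t.1).image fun s =>
      {t.1, t.2.1, t.2.2, s.1, s.2.1, s.2.2}).filter fun S => S.card = 6

theorem card_hexads_le [Fintype V] {𝒜 : Finset (Finset V)} {q : ℕ} (h : ∀ A ∈ 𝒜, A.card = q)
    (h𝒜 : ∀ A ∈ 𝒜, ∀ B ∈ 𝒜, A ≠ B → (A ∩ B).card ≤ 1) :
    (hexads 𝒜).card ≤ Fintype.card V ^ 3 * q ^ 3 := by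
  refine (card_filter_le _ _).trans ?_
  refine (card_biUnion_le_card_mul _ _ (q ^ 3) fun t _ => card_image_le.trans ?_).trans ?_
  · rw [card_product, card_product]
    calc _ ≤ q * (q * q) := Nat.mul_le_mul (card_block_le h h𝒜 _ _)
          (Nat.mul_le_mul (card_block_le h h𝒜 _ _) (card_block_le h h𝒜 _ _))
      _ = q ^ 3 := by ring
  · rw [card_univ, Fintype.card_prod, Fintype.card_prod]
    exact le_of_eq (by ring)

theorem exists_third {e : Finset V} (he : e.card = 3) {a b : V} (ha : a ∈ e) (hb : b ∈ e)
    (hab : a ≠ b) : ∃ x, e = {a, b, x} := by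
  have hb' : b ∈ e.erase a := mem_erase.2 ⟨hab.symm, hb⟩
  have : ((e.erase a).erase b).card = 1 := by
    rw [card_erase_of_mem hb', card_erase_of_mem ha, he]
  obtain ⟨x, hx⟩ := card_eq_one.1 this
  exact ⟨x, by rw [← hx, insert_erase hb', insert_erase ha]⟩

theorem isTriangleFreeTripleSystem_of_free [Fintype V] {𝒜 : Finset (Finset V)}
    (h𝒜 : ∀ A ∈ 𝒜, ∀ B ∈ 𝒜, A ≠ B → (A ∩ B).card ≤ 1) {X : Finset V}
    (h₄ : ∀ S ∈ subsetsOfCard 𝒜 4, ¬ S ⊆ X) (h₆ : ∀ S ∈ hexads 𝒜, ¬ S ⊆ X) :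
    IsTriangleFreeTripleSystem ((subsetsOfCard 𝒜 3).filter (· ⊆ X)) := by
  have hlin : ∀ e ∈ (subsetsOfCard 𝒜 3).filter (· ⊆ X),
      ∀ f ∈ (subsetsOfCard 𝒜 3).filter (· ⊆ X), e ≠ f → (e ∩ f).card ≤ 1 := by
    intro e he f hf hne
    obtain ⟨he, heX⟩ := mem_filter.1 he
    obtain ⟨hf, hfX⟩ := mem_filter.1 hf
    obtain ⟨A, hA, heA, hce⟩ := mem_subsetsOfCard.1 he
    obtain ⟨B, hB, hfB, hcf⟩ := mem_subsetsOfCard.1 hf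
    by_cases hAB : A = B
    · subst hAB
      have hlt : e.card < (e ∪ f).card := card_lt_card
        ⟨subset_union_left, fun h => hne
          (eq_of_subset_of_card_le (subset_union_right.trans h) (by omega)).symm⟩
      obtain ⟨S, hS, hcS⟩ := exists_subset_card_eq (show 4 ≤ (e ∪ f).card by omega)
      exact (h₄ S (mem_subsetsOfCard.2 ⟨A, hA, hS.trans (union_subset heA hfB), hcS⟩)
        (hS.trans (union_subset heX hfX))).elim
    · exact (card_le_card (inter_subset_inter heA hfB)).trans (h𝒜 A hA B hB hAB)
  refine ⟨fun e he => ?_, hlin, ?_⟩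
  · obtain ⟨A, -, -, h⟩ := mem_subsetsOfCard.1 (mem_filter.1 he).1
    exact h
  intro v e he e' he' f hf hve hve' hvf ⟨a, ha⟩ ⟨b, hb⟩
  by_contra hne
  have l₁ := hlin e he e' he' hne
  have l₂ := hlin e he f hf (by rintro rfl; exact hvf hve)
  have l₃ := hlin e' he' f hf (by rintro rfl; exact hvf hve')
  obtain ⟨hae, haf⟩ := mem_inter.1 ha
  obtain ⟨hbe, hbf⟩ := mem_inter.1 hb
  have hva : v ≠ a := by rintro rfl; exact hvf haf
  have hvb : v ≠ b := by rintro rfl; exact hvf hbf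
  have hab : a ≠ b := by
    rintro rfl
    exact hva (card_le_one.1 l₁ v (mem_inter.2 ⟨hve, hve'⟩) a (mem_inter.2 ⟨hae, hbe⟩))
  obtain ⟨he, heX⟩ := mem_filter.1 he
  obtain ⟨he', heX'⟩ := mem_filter.1 he'
  obtain ⟨hf, hfX⟩ := mem_filter.1 hf
  obtain ⟨A, hA, heA, hce⟩ := mem_subsetsOfCard.1 he
  obtain ⟨A', hA', heA', hce'⟩ := mem_subsetsOfCard.1 he'
  obtain ⟨B, hB, hfB, hcf⟩ := mem_subsetsOfCard.1 hf
  obtain ⟨x, hx⟩ := exists_third hce hve hae hva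
  obtain ⟨z, hz⟩ := exists_third hce' hbe hve' hvb.symm
  obtain ⟨y, hy⟩ := exists_third hcf haf hbf hab
  have hS : ({v, a, b, x, y, z} : Finset V) = e ∪ e' ∪ f := by
    rw [hx, hz, hy]
    ext t
    simp only [mem_insert, mem_singleton, mem_union]
    tauto
  have hcard : (e ∪ e' ∪ f).card = 6 := by
    have u₁ := card_union_add_card_inter e e'
    have u₂ := card_union_add_card_inter (e ∪ e') f
    have i₁ : (e ∩ e').card = 1 := le_antisymm l₁ (card_pos.2 ⟨v, mem_inter.2 ⟨hve, hve'⟩⟩)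
    have i₂ : ((e ∪ e') ∩ f).card = 2 := by
      refine le_antisymm ?_ ?_
      · rw [union_inter_distrib_right]
        have := card_union_le (e ∩ f) (e' ∩ f)
        omega
      · rw [← card_pair hab]
        refine card_le_card (insert_subset ?_ (singleton_subset_iff.2 ?_))
        · exact mem_inter.2 ⟨mem_union_left _ hae, haf⟩
        · exact mem_inter.2 ⟨mem_union_right _ hbe, hbf⟩
    omega
  refine h₆ (e ∪ e' ∪ f) (mem_filter.2 ⟨?_, hcard⟩)
    (union_subset (union_subset heX heX') hfX)
  refine mem_biUnion.2 ⟨(v, a, b), mem_univ _, mem_image.2 ⟨(x, y, z), ?_, hS⟩⟩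
  simp only [mem_product]
  exact ⟨mem_block hA hva (heA hve) (heA hae) (heA (by simp [hx])),
    mem_block hB hab (hfB haf) (hfB hbf) (hfB (by simp [hy])),
    mem_block hA' hvb.symm (heA' hbe) (heA' hve') (heA' (by simp [hz]))⟩

theorem exists_hitting_set (ℬ : Finset (Finset V)) (hℬ : ∀ S ∈ ℬ, S.Nonempty) (X : Finset V) :
    ∃ R : Finset V, R.card ≤ (ℬ.filter (· ⊆ X)).card ∧
      ∀ S ∈ ℬ, S ⊆ X → ∃ v ∈ S, v ∈ R := by
  rcases isEmpty_or_nonempty V with h | h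
  · exact ⟨∅, by simp, fun S hS _ => (h.false (hℬ S hS).choose).elim⟩
  choose! r hr using hℬ
  exact ⟨(ℬ.filter (· ⊆ X)).image r, card_image_le, fun S hS hSX =>
    ⟨r S, hr S hS, mem_image_of_mem r (mem_filter.2 ⟨hS, hSX⟩)⟩⟩

theorem card_highDegree_mul_le (𝒯 : Finset (Finset V)) (h𝒯 : ∀ T ∈ 𝒯, T.card = 3) (X : Finset V)
    (D : ℝ) :
    ((X.filter fun v => D < (𝒯.filter (v ∈ ·)).card).card : ℝ) * D ≤ 3 * 𝒯.card := by
  set Y := X.filter fun v => D < (𝒯.filter (v ∈ ·)).card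
  calc (Y.card : ℝ) * D = ∑ _v ∈ Y, D := by simp
    _ ≤ ∑ v ∈ Y, ((𝒯.filter (v ∈ ·)).card : ℝ) :=
        sum_le_sum fun v hv => (mem_filter.1 hv).2.le
    _ = ∑ T ∈ 𝒯, ((Y.filter (· ∈ T)).card : ℝ) := by
        exact_mod_cast sum_card_bipartiteAbove_eq_sum_card_bipartiteBelow (s := Y) (t := 𝒯)
          (fun v T => v ∈ T)
    _ ≤ ∑ _T ∈ 𝒯, (3 : ℝ) := by
        refine sum_le_sum fun T hT => ?_
        have : (Y.filter (· ∈ T)).card ≤ T.card :=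
          card_le_card fun v hv => (mem_filter.1 hv).2
        rw [h𝒯 T hT] at this
        exact_mod_cast this
    _ = 3 * 𝒯.card := by simp [mul_comm]

theorem exists_independent_subset [Fintype V] {𝒜 : Finset (Finset V)}
    (h𝒜 : ∀ A ∈ 𝒜, ∀ B ∈ 𝒜, A ≠ B → (A ∩ B).card ≤ 1) (X : Finset V) {D : ℝ} (hD : 64 ≤ D) :
    ∃ W ⊆ X, (∀ A ∈ 𝒜, ∀ S ⊆ A, S.card = 3 → ¬ S ⊆ W) ∧
      √(Real.log D) / (16 * √D) * (X.card - ((subsetsOfCard 𝒜 4).filter (· ⊆ X)).card -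
        ((hexads 𝒜).filter (· ⊆ X)).card -
        3 / D * ((subsetsOfCard 𝒜 3).filter (· ⊆ X)).card) ≤ W.card := by
  obtain ⟨R₄, hc₄, hR₄⟩ := exists_hitting_set (subsetsOfCard 𝒜 4) (fun S hS => by
    obtain ⟨A, -, -, h⟩ := mem_subsetsOfCard.1 hS
    exact card_pos.1 (by omega)) X
  obtain ⟨R₆, hc₆, hR₆⟩ := exists_hitting_set (hexads 𝒜) (fun S hS => by
    have := (mem_filter.1 hS).2
    exact card_pos.1 (by omega)) X
  set 𝒯 := (subsetsOfCard 𝒜 3).filter (· ⊆ X) with h𝒯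
  set Y := X.filter fun v => D < (𝒯.filter (v ∈ ·)).card with hY
  have hYc : (Y.card : ℝ) ≤ 3 / D * 𝒯.card := by
    have := card_highDegree_mul_le 𝒯 (fun T hT => by
      obtain ⟨A, -, -, h⟩ := mem_subsetsOfCard.1 (mem_filter.1 hT).1
      exact h) X D
    rw [div_mul_eq_mul_div, le_div_iff₀ (by linarith)]
    exact this
  set X' := X \ (R₄ ∪ R₆ ∪ Y) with hX'
  have hsub : X' ⊆ X := sdiff_subset
  have hcard : (X.card : ℝ) - ((subsetsOfCard 𝒜 4).filter (· ⊆ X)).card -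
      ((hexads 𝒜).filter (· ⊆ X)).card - 3 / D * 𝒯.card ≤ X'.card := by
    have h1 : X.card ≤ X'.card + (R₄.card + R₆.card + Y.card) := by
      have h2 : X.card ≤ X'.card + (R₄ ∪ R₆ ∪ Y).card := by
        have := le_card_sdiff (R₄ ∪ R₆ ∪ Y) X
        rw [← hX'] at this
        omega
      have h3 := card_union_le (R₄ ∪ R₆) Y
      have h4 := card_union_le R₄ R₆
      omega
    have h1' : (X.card : ℝ) ≤ X'.card + (R₄.card + R₆.card + Y.card) := by exact_mod_cast h1
    have h5 : (R₄.card : ℝ) ≤ ((subsetsOfCard 𝒜 4).filter (· ⊆ X)).card := by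
      exact_mod_cast hc₄
    have h6 : (R₆.card : ℝ) ≤ ((hexads 𝒜).filter (· ⊆ X)).card := by exact_mod_cast hc₆
    linarith
  have hE := isTriangleFreeTripleSystem_of_free h𝒜 (X := X')
    (fun S hS hSX => by
      obtain ⟨v, hv, hvR⟩ := hR₄ S hS (hSX.trans hsub)
      exact (mem_sdiff.1 (hSX hv)).2 (by simp [hvR]))
    (fun S hS hSX => by
      obtain ⟨v, hv, hvR⟩ := hR₆ S hS (hSX.trans hsub)
      exact (mem_sdiff.1 (hSX hv)).2 (by simp [hvR]))
  obtain ⟨W, hWX, hW, hWc⟩ := exists_large_independent hE (X := X')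
    (fun e he => (mem_filter.1 he).2) hD (fun v => by
      by_cases hv : v ∈ X'
      · obtain ⟨hvX, hvR⟩ := mem_sdiff.1 hv
        have hvY : v ∉ Y := fun h => hvR (mem_union_right _ h)
        have : ¬ D < (𝒯.filter (v ∈ ·)).card := fun h => hvY (mem_filter.2 ⟨hvX, h⟩)
        refine le_trans ?_ (not_lt.1 this)
        refine Nat.cast_le.2 (card_le_card (filter_subset_filter _ ?_))
        exact monotone_filter_right _ fun S _ hS => hS.trans hsub
      · rw [filter_false_of_mem fun e he hve => hv (mem_of_subset (mem_filter.1 he).2 hve)]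
        simp only [card_empty, Nat.cast_zero]
        linarith)
  refine ⟨W, hWX.trans hsub, fun A hA S hS hcS hSW => ?_, le_trans ?_ hWc⟩
  · exact hW S (mem_filter.2 ⟨mem_subsetsOfCard.2 ⟨A, hA, hS, hcS⟩, hSW.trans hWX⟩) hSW
  · exact mul_le_mul_of_nonneg_left hcard (by positivity)

end sampling

section bernoulli

variable {V : Type*} [DecidableEq V] [Fintype V]

theorem sum_bernoulli_superset (p : ℝ) (S : Finset V) :
    ∑ X : Finset V, (p ^ X.card * (1 - p) ^ (univ \ X).card) * (if S ⊆ X then 1 else 0) =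
      p ^ S.card := by
  have h := prod_add (fun _ : V => p) (fun v => if v ∈ S then 0 else 1 - p) univ
  have h1 : ∏ v : V, (p + if v ∈ S then 0 else 1 - p) = p ^ S.card := by
    have : ∀ v : V, (p + if v ∈ S then 0 else 1 - p) = if v ∈ S then p else 1 := by
      intro v
      split_ifs <;> ring
    simp only [this]
    rw [prod_ite_mem, univ_inter, prod_const]
  rw [← h1, h, powerset_univ]
  refine sum_congr rfl fun X _ => ?_
  rw [prod_const, mul_assoc]
  congr 1
  split_ifs with hS
  · rw [mul_one, ← prod_const]
    refine prod_congr rfl fun v hv => ?_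
    rw [if_neg fun h => (mem_sdiff.1 hv).2 (hS h)]
  · obtain ⟨v, hv, hvX⟩ := not_subset.1 hS
    rw [mul_zero, prod_eq_zero (i := v) (by simp [hvX]) (by simp [hv])]

theorem sum_bernoulli_card_filter (p : ℝ) (ℬ : Finset (Finset V)) (k : ℕ)
    (hℬ : ∀ S ∈ ℬ, S.card = k) :
    ∑ X : Finset V, (p ^ X.card * (1 - p) ^ (univ \ X).card) * (ℬ.filter (· ⊆ X)).card =
      ℬ.card * p ^ k := by
  have : ∀ X : Finset V, ((ℬ.filter (· ⊆ X)).card : ℝ) = ∑ S ∈ ℬ, if S ⊆ X then 1 else 0 := by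
    simp
  simp only [this, mul_sum]
  rw [sum_comm]
  simp only [sum_bernoulli_superset]
  rw [sum_congr rfl fun S hS => by rw [hℬ S hS], sum_const, nsmul_eq_mul]

/-- A family of sets of size `k`, one of which can be found in every vertex set `X` for which
`F X` exceeds `k`, must be large if the average of `F` over random sets is large. -/
theorem sum_bernoulli_le_add_card {p : ℝ} (hp₀ : 0 ≤ p) (hp₁ : p ≤ 1) (k : ℕ)
    (ℐ : Finset (Finset V)) (hℐ : ∀ S ∈ ℐ, S.card = k) (F : Finset V → ℝ)
    (hF : ∀ X, F X ≤ Fintype.card V) (h : ∀ X, k < F X → ∃ S ∈ ℐ, S ⊆ X) :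
    ∑ X : Finset V, (p ^ X.card * (1 - p) ^ (univ \ X).card) * F X ≤
      k + Fintype.card V * (ℐ.card * p ^ k) := by
  have hone : ∑ X : Finset V, (p ^ X.card * (1 - p) ^ (univ \ X).card) = 1 := by
    simpa using sum_bernoulli_superset p (∅ : Finset V)
  rw [← sum_bernoulli_card_filter p ℐ k hℐ, mul_sum]
  calc ∑ X : Finset V, (p ^ X.card * (1 - p) ^ (univ \ X).card) * F X
      ≤ ∑ X : Finset V, ((p ^ X.card * (1 - p) ^ (univ \ X).card) * k + Fintype.card V *
          ((p ^ X.card * (1 - p) ^ (univ \ X).card) * (ℐ.filter (· ⊆ X)).card)) := by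
        refine sum_le_sum fun X _ => ?_
        have hw : 0 ≤ p ^ X.card * (1 - p) ^ (univ \ X).card :=
          mul_nonneg (pow_nonneg hp₀ _) (pow_nonneg (by linarith) _)
        have : F X ≤ k + Fintype.card V * (ℐ.filter (· ⊆ X)).card := by
          by_cases hk : k < F X
          · obtain ⟨S, hS, hSX⟩ := h X hk
            have : (1 : ℝ) ≤ (ℐ.filter (· ⊆ X)).card := by
              exact_mod_cast card_pos.2 ⟨S, mem_filter.2 ⟨hS, hSX⟩⟩
            have hn : (0 : ℝ) ≤ Fintype.card V := by positivity
            have hk0 : (0 : ℝ) ≤ k := by positivity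
            nlinarith [hF X]
          · have : (0 : ℝ) ≤ Fintype.card V * (ℐ.filter (· ⊆ X)).card := by positivity
            linarith
        nlinarith
    _ = _ := by rw [sum_add_distrib, ← sum_mul, hone, one_mul]

theorem mul_le_add_card_independent {𝒜 : Finset (Finset V)}
    (h𝒜 : ∀ A ∈ 𝒜, ∀ B ∈ 𝒜, A ≠ B → (A ∩ B).card ≤ 1) {D p : ℝ} (hD : 64 ≤ D) (hp₀ : 0 ≤ p)
    (hp₁ : p ≤ 1) (k : ℕ) (ℐ : Finset (Finset V)) (hℐ : ∀ S ∈ ℐ, S.card = k)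
    (hmem : ∀ S, (∀ A ∈ 𝒜, ∀ T ⊆ A, T.card = 3 → ¬ T ⊆ S) → S.card = k → S ∈ ℐ) :
    √(Real.log D) / (16 * √D) * (Fintype.card V * p - (subsetsOfCard 𝒜 4).card * p ^ 4 -
        (hexads 𝒜).card * p ^ 6 - 3 / D * ((subsetsOfCard 𝒜 3).card * p ^ 3)) ≤
      k + Fintype.card V * (ℐ.card * p ^ k) := by
  have hsub : ∀ j, ∀ S ∈ subsetsOfCard 𝒜 j, S.card = j := fun j S hS => by
    obtain ⟨A, -, -, h⟩ := mem_subsetsOfCard.1 hS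
    exact h
  have hvert : ∑ X : Finset V, (p ^ X.card * (1 - p) ^ (univ \ X).card) * (X.card : ℝ) =
      Fintype.card V * p := by
    have := sum_bernoulli_card_filter p (univ.image fun v : V => ({v} : Finset V)) 1 (by simp)
    rw [card_image_of_injective _ singleton_injective, card_univ, pow_one] at this
    rw [← this]
    refine sum_congr rfl fun X _ => ?_
    rw [filter_image, card_image_of_injective _ singleton_injective]
    simp
  choose W hWX hW hWc using fun X : Finset V => exists_independent_subset h𝒜 X hD
  refine le_trans (le_of_eq ?_) (sum_bernoulli_le_add_card hp₀ hp₁ k ℐ hℐ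
    (fun X => √(Real.log D) / (16 * √D) * (X.card -
      ((subsetsOfCard 𝒜 4).filter (· ⊆ X)).card - ((hexads 𝒜).filter (· ⊆ X)).card -
        3 / D * ((subsetsOfCard 𝒜 3).filter (· ⊆ X)).card)) ?_ ?_)
  · rw [← hvert, ← sum_bernoulli_card_filter p _ 4 (hsub 4),
      ← sum_bernoulli_card_filter p (hexads 𝒜) 6 (fun S hS => (mem_filter.1 hS).2),
      ← sum_bernoulli_card_filter p _ 3 (hsub 3), mul_sum _ _ (3 / D), ← sum_sub_distrib,
      ← sum_sub_distrib, ← sum_sub_distrib, mul_sum]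
    exact sum_congr rfl fun X _ => by ring
  · intro X
    exact (hWc X).trans (by exact_mod_cast card_le_univ _)
  · intro X hX
    have hk : k ≤ (W X).card := by exact_mod_cast (hX.trans_le (hWc X)).le
    obtain ⟨S, hS, hcS⟩ := exists_subset_card_eq hk
    exact ⟨S, hmem S (fun A hA T hT hcT hTS => hW X A hA T hT hcT (hTS.trans hS)) hcS,
      hS.trans (hWX X)⟩

end bernoulli

/-- The numerical step: if `n` sets of size `⌊k₀ / 2⌋` suffice for an average of `k₀`, where `k₀`
is of order `q^(1/2) (log q)^(1/2)`, then `n` is at least exponential in `k₀ log q`. -/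
theorem rpow_le_of_le_floor_add {q y n : ℝ} (hy : 4 ≤ y) (hq : y ^ 12 = q)
    (h : √(Real.log y) * y ^ 6 / 320 ≤ ⌊√(Real.log y) * y ^ 6 / 640⌋₊ +
      q ^ 2 * (n * (y ^ 17)⁻¹ ^ ⌊√(Real.log y) * y ^ 6 / 640⌋₊)) :
    (2 : ℝ) ^ ((1 / 100000 : ℝ) * q ^ ((1 : ℝ) / 2) * Real.log q ^ ((3 : ℝ) / 2)) ≤ n := by
  have hy0 : 0 < y := by linarith
  have hlog1 : 1 ≤ Real.log y := by
    rw [Real.le_log_iff_exp_le hy0]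
    linarith [Real.exp_one_lt_d9]
  set s := √(Real.log y) with hs
  have hss : s ^ 2 = Real.log y := Real.sq_sqrt (by linarith)
  have hs1 : 1 ≤ s := Real.one_le_sqrt.2 hlog1
  have hy6 : 4096 ≤ y ^ 6 := by
    calc (4096 : ℝ) = 4 ^ 6 := by norm_num
      _ ≤ y ^ 6 := by gcongr
  have hbig : 4096 ≤ s * y ^ 6 := by nlinarith
  set k := ⌊s * y ^ 6 / 640⌋₊ with hk
  have hk1 : (k : ℝ) ≤ s * y ^ 6 / 640 := Nat.floor_le (by positivity)
  have hk2 : s * y ^ 6 / 640 < k + 1 := Nat.lt_floor_add_one _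
  have hk3 : 2 ≤ k := by
    have : (5 : ℝ) < k + 1 := by linarith
    have : 5 < k + 1 := by exact_mod_cast this
    omega
  have h1 : 1 ≤ y ^ 24 * (n * (y ^ 17)⁻¹ ^ k) := by
    rw [← hq, ← pow_mul] at h
    norm_num at h ⊢
    linarith
  have h2 : y ^ (17 * k) ≤ y ^ 24 * n := by
    have hp : 0 < y ^ (17 * k) := by positivity
    have : y ^ 24 * (n * (y ^ 17)⁻¹ ^ k) = y ^ 24 * n / y ^ (17 * k) := by
      rw [inv_pow, ← pow_mul, div_eq_mul_inv, mul_assoc]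
    rw [this, le_div_iff₀ hp, one_mul] at h1
    exact h1
  have h3 : y ^ k ≤ n := by
    have : y ^ 24 * y ^ k ≤ y ^ 24 * n := by
      refine le_trans ?_ h2
      rw [← pow_add]
      exact pow_le_pow_right₀ (by linarith) (by omega)
    exact le_of_mul_le_mul_left this (by positivity)
  refine le_trans ?_ h3
  have hq2 : q ^ ((1 : ℝ) / 2) = y ^ 6 := by
    rw [← Real.sqrt_eq_rpow, ← hq, show y ^ 12 = (y ^ 6) ^ 2 by ring,
      Real.sqrt_sq (by positivity)]
  have hlq : Real.log q = 12 * s ^ 2 := by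
    rw [← hq, Real.log_pow, hss]
    norm_num
  have hl32 : Real.log q ^ ((3 : ℝ) / 2) ≤ 64 * s ^ 3 := by
    calc Real.log q ^ ((3 : ℝ) / 2) ≤ ((4 * s) ^ 2) ^ ((3 : ℝ) / 2) := by
          rw [hlq]
          gcongr
          nlinarith
      _ = 64 * s ^ 3 := by
          rw [← Real.rpow_natCast_mul (by positivity)]
          norm_num
          ring
  have hkey : (1 / 100000 : ℝ) * q ^ ((1 : ℝ) / 2) * Real.log q ^ ((3 : ℝ) / 2) ≤
      Real.log y * k := by
    calc (1 / 100000 : ℝ) * q ^ ((1 : ℝ) / 2) * Real.log q ^ ((3 : ℝ) / 2)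
        ≤ 1 / 100000 * y ^ 6 * (64 * s ^ 3) := by rw [hq2]; gcongr
      _ = s ^ 2 * (64 / 100000 * (s * y ^ 6)) := by ring
      _ ≤ s ^ 2 * k := by
          gcongr
          linarith
      _ = Real.log y * k := by rw [hss]
  have hexp : y ^ k = Real.exp (Real.log y * k) := by
    rw [← Real.rpow_natCast, Real.rpow_def_of_pos hy0]
  have hnn : 0 ≤ (1 / 100000 : ℝ) * q ^ ((1 : ℝ) / 2) * Real.log q ^ ((3 : ℝ) / 2) := by
    rw [hq2, hlq]
    positivity
  rw [hexp, Real.rpow_def_of_pos two_pos]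
  refine Real.exp_le_exp.2 (le_trans ?_ hkey)
  exact mul_le_of_le_one_left hnn (by linarith [Real.log_two_lt_d9])

/-- There are `c > 0` and `q₀` such that for every `q ≥ q₀`: every 3-uniform hypergraph on
`q²` vertices whose edges are all the 3-element subsets of members of a family of at most
`2q²` `q`-element vertex sets, pairwise sharing at most one vertex, has at least
`2^(c · q^(1/2) · (log q)^(3/2))` independent sets. -/
theorem stmt8 :
    ∃ c : ℝ, 0 < c ∧ ∃ q₀ : ℕ, ∀ q : ℕ, q₀ ≤ q →
      ∀ (V : Type) [Fintype V] [DecidableEq V], Fintype.card V = q ^ 2 →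
      ∀ 𝒜 : Finset (Finset V), 𝒜.card ≤ 2 * q ^ 2 →
        (∀ A ∈ 𝒜, A.card = q) →
        (∀ A ∈ 𝒜, ∀ B ∈ 𝒜, A ≠ B → (A ∩ B).card ≤ 1) →
        (2 : ℝ) ^ (c * (q : ℝ) ^ ((1 : ℝ) / 2) * Real.log q ^ ((3 : ℝ) / 2)) ≤
          Nat.card {I : Finset V // ∀ A ∈ 𝒜, ∀ S ⊆ A, S.card = 3 → ¬S ⊆ I} := by
  classical
  refine ⟨1 / 100000, by norm_num, 4 ^ 12, fun q hq V _ _ hV 𝒜 hc hA h𝒜 => ?_⟩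
  obtain ⟨y, hy4, hyq⟩ : ∃ y : ℝ, 4 ≤ y ∧ y ^ 12 = q := by
    have hq' : (4 : ℝ) ^ 12 ≤ q := by exact_mod_cast hq
    have h : ((q : ℝ) ^ ((1 : ℝ) / (12 : ℕ))) ^ 12 = q := by
      rw [one_div]
      exact Real.rpow_inv_natCast_pow (Nat.cast_nonneg q) (by norm_num)
    refine ⟨_, ?_, h⟩
    refine le_of_pow_le_pow_left₀ (n := 12) (by norm_num) (by positivity) ?_
    rw [h]
    exact hq'
  have hy0 : 0 < y := by linarith
  set k := ⌊√(Real.log y) * y ^ 6 / 640⌋₊ with hk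
  set ℐ : Finset (Finset V) := univ.filter fun I =>
    (∀ A ∈ 𝒜, ∀ S ⊆ A, S.card = 3 → ¬S ⊆ I) ∧ I.card = k with hℐ
  have hcard : (ℐ.card : ℝ) ≤
      Nat.card {I : Finset V // ∀ A ∈ 𝒜, ∀ S ⊆ A, S.card = 3 → ¬S ⊆ I} := by
    rw [Nat.card_eq_fintype_card, Fintype.card_subtype]
    refine Nat.cast_le.2 (card_le_card fun I hI => ?_)
    simp only [hℐ, mem_filter, mem_univ, true_and] at hI ⊢
    exact hI.1
  refine le_trans (rpow_le_of_le_floor_add hy4 hyq ?_) hcard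
  have hVq : (Fintype.card V : ℝ) = y ^ 24 := by
    rw [hV, Nat.cast_pow, ← hyq]
    ring
  have hD : 64 ≤ 24 * y ^ 2 := by nlinarith
  have hp1 : (y ^ 17)⁻¹ ≤ 1 := inv_le_one_of_one_le₀ (one_le_pow₀ (by linarith))
  have key := mul_le_add_card_independent h𝒜 hD (p := (y ^ 17)⁻¹) (by positivity) hp1 k ℐ
    (fun S hS => (mem_filter.1 hS).2.2) (fun S h h' => mem_filter.2 ⟨mem_univ _, h, h'⟩)
  rw [show (q : ℝ) ^ 2 = Fintype.card V by rw [hV]; push_cast; ring]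
  refine le_trans ?_ key
  have hcR : (𝒜.card : ℝ) ≤ 2 * y ^ 24 := by
    have : (𝒜.card : ℝ) ≤ 2 * (q : ℝ) ^ 2 := by exact_mod_cast hc
    rw [← hyq, ← pow_mul] at this
    exact this
  have hsub : ∀ j, ((subsetsOfCard 𝒜 j).card : ℝ) ≤ 2 * y ^ 24 * (y ^ 12) ^ j := by
    intro j
    have : ((subsetsOfCard 𝒜 j).card : ℝ) ≤ 𝒜.card * (q : ℝ) ^ j := by
      exact_mod_cast card_subsetsOfCard_le hA j
    rw [← hyq] at this
    refine this.trans ?_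
    gcongr
  have hhex : ((hexads 𝒜).card : ℝ) ≤ (y ^ 24) ^ 3 * (y ^ 12) ^ 3 := by
    rw [← hVq, hyq]
    exact_mod_cast card_hexads_le hA h𝒜
  have b₄ : ((subsetsOfCard 𝒜 4).card : ℝ) * (y ^ 17)⁻¹ ^ 4 ≤ 2 * y ^ 4 := by
    calc _ ≤ 2 * y ^ 24 * (y ^ 12) ^ 4 * (y ^ 17)⁻¹ ^ 4 := by gcongr; exact hsub 4
      _ = 2 * y ^ 4 := by field_simp
  have b₆ : ((hexads 𝒜).card : ℝ) * (y ^ 17)⁻¹ ^ 6 ≤ y ^ 6 := by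
    calc _ ≤ (y ^ 24) ^ 3 * (y ^ 12) ^ 3 * (y ^ 17)⁻¹ ^ 6 := by gcongr
      _ = y ^ 6 := by field_simp
  have b₃ : 3 / (24 * y ^ 2) * (((subsetsOfCard 𝒜 3).card : ℝ) * (y ^ 17)⁻¹ ^ 3) ≤ y ^ 7 / 4 := by
    calc _ ≤ 3 / (24 * y ^ 2) * (2 * y ^ 24 * (y ^ 12) ^ 3 * (y ^ 17)⁻¹ ^ 3) := by
          gcongr
          exact hsub 3
      _ = y ^ 7 / 4 := by
          field_simp
          norm_num
  have b₁ : (Fintype.card V : ℝ) * (y ^ 17)⁻¹ = y ^ 7 := by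
    rw [hVq]
    field_simp
  have e₁ : 4 * y ^ 6 ≤ y ^ 7 := by
    nlinarith [pow_pos hy0 6]
  have e₂ : 16 * y ^ 4 ≤ y ^ 6 := by
    have : 16 ≤ y ^ 2 := by nlinarith
    nlinarith [pow_pos hy0 4]
  have hlog : √(Real.log y) ≤ √(Real.log (24 * y ^ 2)) :=
    Real.sqrt_le_sqrt (Real.log_le_log hy0 (by nlinarith))
  have hsq : √(24 * y ^ 2) ≤ 5 * y := by
    rw [Real.sqrt_le_left (by positivity)]
    nlinarith [sq_nonneg y]
  have hκ : √(Real.log y) / (16 * (5 * y)) ≤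
      √(Real.log (24 * y ^ 2)) / (16 * √(24 * y ^ 2)) := by
    gcongr
  calc √(Real.log y) * y ^ 6 / 320 = √(Real.log y) / (16 * (5 * y)) * (y ^ 7 / 4) := by
        field_simp
        ring
    _ ≤ _ := by
        refine mul_le_mul hκ ?_ (by positivity) (by positivity)
        rw [b₁]
        linarith [pow_pos hy0 7, pow_pos hy0 6, pow_pos hy0 4]
end

section
/- For every integer s ≥ 1 there exists a constant c > 0 such that every 3-uniform hypergraph on n vertices with m edges, average degree d = 3m/n ≥ 2, and maximum codegree at most s has at least 2^{c · n · (log d)^{3/2} / d^{1/2}} independent sets. -/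
/-- The indicator of a proposition, as a real number. -/
noncomputable def indic (P : Prop) : ℝ := open Classical in if P then 1 else 0

theorem indic_nonneg (P : Prop) : 0 ≤ indic P := by
  unfold indic; split_ifs <;> norm_num

theorem indic_le_one (P : Prop) : indic P ≤ 1 := by
  unfold indic; split_ifs <;> norm_num

theorem indic_of_true {P : Prop} (h : P) : indic P = 1 := by simp [indic, h]

theorem indic_of_false {P : Prop} (h : ¬P) : indic P = 0 := by simp [indic, h]

theorem indic_mono {P Q : Prop} (h : P → Q) : indic P ≤ indic Q := by
  by_cases hP : P
  · rw [indic_of_true hP, indic_of_true (h hP)]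
  · rw [indic_of_false hP]; exact indic_nonneg Q

theorem indic_or_le (P Q : Prop) : indic (P ∨ Q) ≤ indic P + indic Q := by
  by_cases hP : P
  · rw [indic_of_true hP, indic_of_true (Or.inl hP)]; linarith [indic_nonneg Q]
  · rw [indic_of_false hP, zero_add]; exact indic_mono (fun h => h.resolve_left hP)

theorem sum_filter_not_eq_sum_indic {V : Type*} (A : Finset V) (P : V → Prop)
    [DecidablePred fun v => ¬P v] (f : V → ℝ) :
    ∑ v ∈ A.filter (fun v => ¬P v), f v = ∑ v ∈ A, (1 - indic (P v)) * f v := by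
  rw [Finset.sum_filter]
  refine Finset.sum_congr rfl fun v _ => ?_
  by_cases h : P v <;> simp [h, indic]

/-- The ordered-triple form of a linear 3-uniform hypergraph without triangles. -/
structure IsUncrowded {V : Type*} (r : V → V → V → Prop) : Prop where
  swap : ∀ a b c, r a b c → r b a c
  rot : ∀ a b c, r a b c → r b c a
  ne : ∀ a b c, r a b c → a ≠ b
  linear : ∀ a b c c', r a b c → r a b c' → c = c'
  triangle : ∀ a b c x y z, a ≠ b → b ≠ c → a ≠ c → r a b x → r b c y → r a c z → r a b c

section Nibble

variable {V : Type*}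

/-- `v` is removed from the pool when `u` joins the partial independent set `W`. -/
def Blocks (r : V → V → V → Prop) (W : Finset V) (u v : V) : Prop :=
  u = v ∨ ∃ p ∈ W, r p u v

/-- A partial independent set `W` together with a pool `A` of vertices each of which can still
be added to `W`, weighted by `Ω` with values in `[1, M]`. -/
structure IsPartial (r : V → V → V → Prop) (M : ℝ) (W A : Finset V) (Ω : V → ℝ) : Prop where
  disj : ∀ v ∈ A, v ∉ W
  indep : ∀ a ∈ W, ∀ b ∈ W, ∀ c ∈ W, ¬r a b c
  avail : ∀ a ∈ W, ∀ b ∈ W, ∀ c ∈ A, ¬r a b c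
  one_le : ∀ v ∈ A, 1 ≤ Ω v
  le_top : ∀ v ∈ A, Ω v ≤ M

/-- The total weight of the pool. -/
def poolWeight (A : Finset V) (Ω : V → ℝ) : ℝ := ∑ v ∈ A, Ω v

/-- The entropy-like weight of the pool. -/
noncomputable def logWeight (A : Finset V) (Ω : V → ℝ) : ℝ := ∑ v ∈ A, Ω v * Real.log (Ω v)

/-- The weight of ordered pairs in the pool completed to an edge by a vertex of `W`. -/
noncomputable def pairWeight (r : V → V → V → Prop) (W A : Finset V) (Ω : V → ℝ) : ℝ :=
  ∑ u ∈ A, ∑ w ∈ A, Ω u * Ω w * indic (∃ p ∈ W, r p u w)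

/-- The weight of ordered edges inside the pool. -/
noncomputable def tripleWeight (r : V → V → V → Prop) (A : Finset V) (Ω : V → ℝ) : ℝ :=
  ∑ u ∈ A, ∑ v ∈ A, ∑ w ∈ A, Ω u * Ω v * Ω w * indic (r u v w)

/-- The weight of the pool vertices whose selection removes `v`. -/
noncomputable def hazard (r : V → V → V → Prop) (W A : Finset V) (Ω : V → ℝ) (v : V) : ℝ :=
  ∑ u ∈ A, Ω u * indic (Blocks r W u v)

variable {r : V → V → V → Prop} {M : ℝ} {W A : Finset V} {Ω : V → ℝ}

/-- Exchanging the last two arguments. -/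
theorem IsUncrowded.swap_right (hr : IsUncrowded r) {a b c : V} (h : r a b c) : r a c b :=
  hr.rot _ _ _ (hr.swap _ _ _ h)

theorem IsPartial.pos (hP : IsPartial r M W A Ω) {v : V} (hv : v ∈ A) : 0 < Ω v :=
  lt_of_lt_of_le one_pos (hP.one_le v hv)

theorem IsPartial.hazard_nonneg (hP : IsPartial r M W A Ω) (v : V) : 0 ≤ hazard r W A Ω v :=
  Finset.sum_nonneg fun _ hu => mul_nonneg (hP.pos hu).le (indic_nonneg _)

theorem IsPartial.hazard_le (hP : IsPartial r M W A Ω) (v : V) :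
    hazard r W A Ω v ≤ poolWeight A Ω :=
  Finset.sum_le_sum fun _ hu => mul_le_of_le_one_right (hP.pos hu).le (indic_le_one _)

theorem IsPartial.poolWeight_nonneg (hP : IsPartial r M W A Ω) : 0 ≤ poolWeight A Ω :=
  Finset.sum_nonneg fun _ hu => (hP.pos hu).le

theorem IsPartial.poolWeight_le (hP : IsPartial r M W A Ω) : poolWeight A Ω ≤ A.card * M := by
  have := Finset.sum_le_card_nsmul A Ω M hP.le_top
  simpa [poolWeight] using this

/-- Two adjacent pool vertices are simultaneously removed only when one of them is selected. -/
theorem IsPartial.blocks_pair (hr : IsUncrowded r) (hP : IsPartial r M W A Ω) {z u w : V}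
    (hw : w ∈ A) (huw : ∃ p ∈ W, r p u w)
    (h₁ : Blocks r W z u) (h₂ : Blocks r W z w) : z = u ∨ z = w := by
  rcases h₁ with h₁ | ⟨p, hp, hpu⟩
  · exact Or.inl h₁
  rcases h₂ with h₂ | ⟨q, hq, hqw⟩
  · exact Or.inr h₂
  exfalso
  obtain ⟨t, ht, htuw⟩ := huw
  have e1 := hr.rot _ _ _ hpu
  have e2 := hr.rot _ _ _ hqw
  have e3 := hr.rot _ _ _ htuw
  have key := hr.triangle z u w p t q (hr.ne _ _ _ e1) (hr.ne _ _ _ e3) (hr.ne _ _ _ e2) e1 e3 e2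
  have := hr.linear _ _ _ _ key e1
  exact hP.disj w hw (this ▸ hp)

/-- Two vertices of an edge inside the pool are never removed simultaneously. -/
theorem IsPartial.not_blocks_of_edge (hr : IsUncrowded r) (hP : IsPartial r M W A Ω) {z u v w : V}
    (hv : v ∈ A) (hw : w ∈ A) (h : r u v w)
    (h₁ : Blocks r W z u) (h₂ : Blocks r W z v) : False := by
  have huv : ∀ p ∈ W, ¬r p u v := fun p hp hpu =>
    hP.disj w hw (hr.linear _ _ _ _ h (hr.rot _ _ _ hpu) ▸ hp)
  rcases h₁ with rfl | ⟨p, hp, hpu⟩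
  · rcases h₂ with rfl | ⟨q, hq, hqv⟩
    · exact hr.ne _ _ _ h rfl
    · exact huv q hq hqv
  rcases h₂ with rfl | ⟨q, hq, hqv⟩
  · exact huv p hp (hr.swap_right hpu)
  have e1 := hr.rot _ _ _ hpu
  have e2 := hr.rot _ _ _ hqv
  have key := hr.triangle z u v p w q (hr.ne _ _ _ e1) (hr.ne _ _ _ h) (hr.ne _ _ _ e2) e1 h e2
  exact hP.disj v hv (hr.linear _ _ _ _ key e1 ▸ hp)

open Classical in
/-- The pool after `z` has been selected. -/
noncomputable def poolAfter (r : V → V → V → Prop) (W A : Finset V) (z : V) : Finset V :=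
  A.filter fun v => ¬Blocks r W z v

open Classical in
/-- The pool after a step of length `δ` in which nothing has been selected. -/
noncomputable def poolIdle (r : V → V → V → Prop) (M δ : ℝ) (W A : Finset V) (Ω : V → ℝ) :
    Finset V :=
  A.filter fun v => ¬M < Ω v * (1 + δ * hazard r W A Ω v)

/-- The weights after a step of length `δ` in which nothing has been selected. -/
noncomputable def weightIdle (r : V → V → V → Prop) (δ : ℝ) (W A : Finset V) (Ω : V → ℝ) (v : V) :
    ℝ :=
  Ω v * (1 + δ * hazard r W A Ω v)

/-- The weight discarded after an idle step. -/
noncomputable def lossIdle (r : V → V → V → Prop) (M δ : ℝ) (W A : Finset V) (Ω : V → ℝ) : ℝ :=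
  ∑ v ∈ A, indic (M < Ω v * (1 + δ * hazard r W A Ω v)) * weightIdle r δ W A Ω v

/-- The total removal rate of weight from the pool. -/
noncomputable def removalRate (r : V → V → V → Prop) (W A : Finset V) (Ω : V → ℝ) : ℝ :=
  ∑ v ∈ A, Ω v * hazard r W A Ω v

/-- The mean of a quantity after one step of length `δ`: the value is `f z` if `z` is selected and
`f₀` if nothing is. -/
def stepMean (δ : ℝ) (A : Finset V) (Ω : V → ℝ) (f : V → ℝ) (f₀ : ℝ) : ℝ :=
  ∑ z ∈ A, δ * Ω z * f z + (1 - δ * poolWeight A Ω) * f₀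

theorem sum_poolAfter (z : V) (f : V → ℝ) :
    ∑ v ∈ poolAfter r W A z, f v = ∑ v ∈ A, (1 - indic (Blocks r W z v)) * f v := by
  classical exact sum_filter_not_eq_sum_indic A _ f

theorem sum_survive_one (v : V) :
    ∑ z ∈ A, Ω z * (1 - indic (Blocks r W z v)) = poolWeight A Ω - hazard r W A Ω v := by
  simp only [mul_sub, mul_one, Finset.sum_sub_distrib, poolWeight, hazard]

theorem stepMean_poolWeight (δ : ℝ) :
    stepMean δ A Ω (fun z => poolWeight (poolAfter r W A z) Ω)
        (poolWeight (poolIdle r M δ W A Ω) (weightIdle r δ W A Ω)) =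
      poolWeight A Ω - δ ^ 2 * poolWeight A Ω * removalRate r W A Ω -
        (1 - δ * poolWeight A Ω) * lossIdle r M δ W A Ω := by
  have h1 : ∑ z ∈ A, δ * Ω z * poolWeight (poolAfter r W A z) Ω =
      δ * (poolWeight A Ω ^ 2 - removalRate r W A Ω) := by
    have : ∀ z, poolWeight (poolAfter r W A z) Ω =
        ∑ v ∈ A, (1 - indic (Blocks r W z v)) * Ω v := fun z =>
      sum_poolAfter z Ω
    simp only [this, Finset.mul_sum]
    rw [Finset.sum_comm]
    have : ∀ v ∈ A, ∑ z ∈ A, δ * Ω z * ((1 - indic (Blocks r W z v)) * Ω v) =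
        δ * (Ω v * poolWeight A Ω - Ω v * hazard r W A Ω v) := by
      intro v _
      rw [← mul_sub, ← sum_survive_one, Finset.mul_sum, Finset.mul_sum]
      exact Finset.sum_congr rfl fun z _ => by ring
    rw [Finset.sum_congr rfl this, ← Finset.mul_sum, Finset.sum_sub_distrib, ← Finset.sum_mul]
    simp only [removalRate, poolWeight]; ring
  have h2 : poolWeight (poolIdle r M δ W A Ω) (weightIdle r δ W A Ω) =
      poolWeight A Ω + δ * removalRate r W A Ω - lossIdle r M δ W A Ω := by
    have : poolWeight (poolIdle r M δ W A Ω) (weightIdle r δ W A Ω) = _ :=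
      sum_filter_not_eq_sum_indic A _ _
    rw [this]
    simp only [sub_mul, one_mul, Finset.sum_sub_distrib, lossIdle]
    congr 1
    simp only [weightIdle, mul_add, mul_one, Finset.sum_add_distrib, poolWeight, removalRate,
      Finset.mul_sum]
    congr 1
    exact Finset.sum_congr rfl fun z _ => by ring
  rw [stepMean, h1, h2]; ring

theorem stepMean_logWeight_le (hP : IsPartial r M W A Ω) {δ : ℝ} (hδ : 0 ≤ δ)
    (hδA : δ * poolWeight A Ω ≤ 1) (hM : 0 < M) :
    stepMean δ A Ω (fun z => logWeight (poolAfter r W A z) Ω)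
        (logWeight (poolIdle r M δ W A Ω) (weightIdle r δ W A Ω)) ≤
      logWeight A Ω + δ * removalRate r W A Ω -
        (1 - δ * poolWeight A Ω) * (Real.log M * lossIdle r M δ W A Ω) := by
  set Y := poolWeight A Ω with hY
  have h1 : ∑ z ∈ A, δ * Ω z * logWeight (poolAfter r W A z) Ω =
      ∑ v ∈ A, δ * (Ω v * Real.log (Ω v)) * (Y - hazard r W A Ω v) := by
    have : ∀ z, logWeight (poolAfter r W A z) Ω =
        ∑ v ∈ A, (1 - indic (Blocks r W z v)) * (Ω v * Real.log (Ω v)) := fun z =>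
      sum_poolAfter z _
    simp only [this, Finset.mul_sum]
    rw [Finset.sum_comm]
    refine Finset.sum_congr rfl fun v _ => ?_
    rw [hY, ← sum_survive_one, Finset.mul_sum]
    exact Finset.sum_congr rfl fun z _ => by ring
  have h2 : logWeight (poolIdle r M δ W A Ω) (weightIdle r δ W A Ω) ≤
      ∑ v ∈ A, (weightIdle r δ W A Ω v * (Real.log (Ω v) + δ * hazard r W A Ω v) -
        Real.log M * (indic (M < Ω v * (1 + δ * hazard r W A Ω v)) * weightIdle r δ W A Ω v)) := by
    have : logWeight (poolIdle r M δ W A Ω) (weightIdle r δ W A Ω) = _ :=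
      sum_filter_not_eq_sum_indic A _ _
    rw [this]
    refine Finset.sum_le_sum fun v hv => ?_
    have ha : 0 ≤ δ * hazard r W A Ω v := mul_nonneg hδ (hP.hazard_nonneg v)
    have hpos := hP.pos hv
    have hw : 0 < weightIdle r δ W A Ω v := mul_pos hpos (by linarith)
    have hlog : Real.log (weightIdle r δ W A Ω v) ≤ Real.log (Ω v) + δ * hazard r W A Ω v := by
      rw [weightIdle, Real.log_mul hpos.ne' (by linarith)]
      linarith [Real.log_le_sub_one_of_pos (show 0 < 1 + δ * hazard r W A Ω v by linarith)]
    by_cases hk : M < Ω v * (1 + δ * hazard r W A Ω v)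
    · rw [indic_of_true hk]
      have : Real.log M ≤ Real.log (weightIdle r δ W A Ω v) := Real.log_le_log hM hk.le
      nlinarith
    · rw [indic_of_false hk]
      nlinarith
  have h3 : (1 - δ * Y) * logWeight (poolIdle r M δ W A Ω) (weightIdle r δ W A Ω) ≤
      (1 - δ * Y) * ∑ v ∈ A, (weightIdle r δ W A Ω v * (Real.log (Ω v) + δ * hazard r W A Ω v)) -
        (1 - δ * Y) * (Real.log M * lossIdle r M δ W A Ω) := by
    rw [← mul_sub, lossIdle, Finset.mul_sum (a := Real.log M), ← Finset.sum_sub_distrib]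
    exact mul_le_mul_of_nonneg_left h2 (by linarith)
  have h4 : ∑ v ∈ A, δ * (Ω v * Real.log (Ω v)) * (Y - hazard r W A Ω v) +
      (1 - δ * Y) * ∑ v ∈ A, (weightIdle r δ W A Ω v * (Real.log (Ω v) + δ * hazard r W A Ω v)) ≤
      logWeight A Ω + δ * removalRate r W A Ω := by
    rw [logWeight, removalRate, Finset.mul_sum, Finset.mul_sum, ← Finset.sum_add_distrib,
      ← Finset.sum_add_distrib]
    refine Finset.sum_le_sum fun v hv => ?_
    have ha : 0 ≤ δ * hazard r W A Ω v := mul_nonneg hδ (hP.hazard_nonneg v)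
    have hal : δ * hazard r W A Ω v ≤ δ * Y := mul_le_mul_of_nonneg_left (hP.hazard_le v) hδ
    have hg : 0 ≤ Real.log (Ω v) := Real.log_nonneg (hP.one_le v hv)
    have hpos := hP.pos hv
    rw [weightIdle]
    set a := δ * hazard r W A Ω v with haa
    set g := Real.log (Ω v)
    have e1 : δ * (Ω v * g) * (Y - hazard r W A Ω v) = Ω v * g * (δ * Y - a) := by
      rw [haa]; ring
    have e2 : δ * (Ω v * hazard r W A Ω v) = Ω v * a := by rw [haa]; ring
    rw [e1, e2]
    set l := δ * Y
    have k1 : (1 - l) * (1 + a) ≤ 1 := by nlinarith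
    have k2 : g * (l - a) + (1 - l) * (1 + a) * (g + a) ≤ g + a := by
      have : g * ((l - a) + (1 - l) * (1 + a)) ≤ g * 1 :=
        mul_le_mul_of_nonneg_left (by nlinarith) hg
      nlinarith
    calc _ = Ω v * (g * (l - a) + (1 - l) * (1 + a) * (g + a)) := by ring
      _ ≤ Ω v * (g + a) := mul_le_mul_of_nonneg_left k2 hpos.le
      _ = _ := by ring
  rw [stepMean, h1]
  linarith

theorem sum_filter_le_sum (A : Finset V) (P : V → Prop) [DecidablePred P] {f : V → ℝ}
    (hf : ∀ v ∈ A, 0 ≤ f v) : ∑ v ∈ A.filter P, f v ≤ ∑ v ∈ A, f v :=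
  Finset.sum_le_sum_of_subset_of_nonneg (Finset.filter_subset _ _) fun v hv _ => hf v hv

theorem IsPartial.weightIdle_nonneg (hP : IsPartial r M W A Ω) {δ : ℝ} (hδ : 0 ≤ δ) {v : V}
    (hv : v ∈ A) : 0 ≤ weightIdle r δ W A Ω v :=
  mul_nonneg (hP.pos hv).le (by linarith [mul_nonneg hδ (hP.hazard_nonneg v)])

theorem stepMean_tripleWeight_le (hr : IsUncrowded r) (hP : IsPartial r M W A Ω) {δ : ℝ}
    (hδ : 0 ≤ δ) (hδA : δ * poolWeight A Ω ≤ 1) :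
    stepMean δ A Ω (fun z => tripleWeight r (poolAfter r W A z) Ω)
        (tripleWeight r (poolIdle r M δ W A Ω) (weightIdle r δ W A Ω)) ≤ tripleWeight r A Ω := by
  set Y := poolWeight A Ω with hY
  have hΩ := fun v (hv : v ∈ A) => (hP.pos hv).le
  have hΩ' := fun v (hv : v ∈ A) => hP.weightIdle_nonneg hδ hv
  have h1 : ∑ z ∈ A, δ * Ω z * tripleWeight r (poolAfter r W A z) Ω =
      ∑ u ∈ A, ∑ v ∈ A, ∑ w ∈ A, ∑ z ∈ A, δ * Ω z * ((1 - indic (Blocks r W z u)) *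
        (1 - indic (Blocks r W z v)) * (1 - indic (Blocks r W z w)) *
        (Ω u * Ω v * Ω w * indic (r u v w))) := by
    have : ∀ z, δ * Ω z * tripleWeight r (poolAfter r W A z) Ω =
        ∑ u ∈ A, ∑ v ∈ A, ∑ w ∈ A, δ * Ω z * ((1 - indic (Blocks r W z u)) *
        (1 - indic (Blocks r W z v)) * (1 - indic (Blocks r W z w)) *
        (Ω u * Ω v * Ω w * indic (r u v w))) := by
      intro z
      rw [tripleWeight]
      simp only [sum_poolAfter, Finset.mul_sum]
      exact Finset.sum_congr rfl fun _ _ => Finset.sum_congr rfl fun _ _ =>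
        Finset.sum_congr rfl fun _ _ => by ring
    rw [Finset.sum_congr rfl fun z _ => this z, Finset.sum_comm]
    refine Finset.sum_congr rfl fun u _ => ?_
    rw [Finset.sum_comm]
    refine Finset.sum_congr rfl fun v _ => ?_
    rw [Finset.sum_comm]
  have h2 : tripleWeight r (poolIdle r M δ W A Ω) (weightIdle r δ W A Ω) ≤
      tripleWeight r A (weightIdle r δ W A Ω) := by
    have nn : ∀ u ∈ A, ∀ v ∈ A, ∀ w ∈ A, 0 ≤ weightIdle r δ W A Ω u * weightIdle r δ W A Ω v *
        weightIdle r δ W A Ω w * indic (r u v w) := fun u hu v hv w hw =>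
      mul_nonneg (mul_nonneg (mul_nonneg (hΩ' u hu) (hΩ' v hv)) (hΩ' w hw)) (indic_nonneg _)
    have hsub : poolIdle r M δ W A Ω ⊆ A := Finset.filter_subset _ _
    rw [tripleWeight, tripleWeight]
    calc _ ≤ ∑ u ∈ poolIdle r M δ W A Ω, ∑ v ∈ A, ∑ w ∈ A, weightIdle r δ W A Ω u *
          weightIdle r δ W A Ω v * weightIdle r δ W A Ω w * indic (r u v w) := by
          refine Finset.sum_le_sum fun u hu => ?_
          calc _ ≤ ∑ v ∈ poolIdle r M δ W A Ω, ∑ w ∈ A, weightIdle r δ W A Ω u *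
                weightIdle r δ W A Ω v * weightIdle r δ W A Ω w * indic (r u v w) :=
                Finset.sum_le_sum fun v hv =>
                  sum_filter_le_sum A _ fun w hw => nn u (hsub hu) v (hsub hv) w hw
            _ ≤ _ := sum_filter_le_sum A _ fun v hv =>
                Finset.sum_nonneg fun w hw => nn u (hsub hu) v hv w hw
      _ ≤ _ := sum_filter_le_sum A _ fun u hu => Finset.sum_nonneg fun v hv =>
          Finset.sum_nonneg fun w hw => nn u hu v hv w hw
  rw [stepMean, h1]
  refine (add_le_add_right (mul_le_mul_of_nonneg_left h2 (by linarith)) _).trans ?_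
  rw [tripleWeight, tripleWeight]
  simp only [Finset.mul_sum, ← Finset.sum_add_distrib]
  refine Finset.sum_le_sum fun u hu => Finset.sum_le_sum fun v hv => Finset.sum_le_sum fun w hw => ?_
  by_cases huvw : r u v w
  swap
  · simp [indic_of_false huvw]
  rw [indic_of_true huvw]
  have hd : ∀ z ∈ A, (1 - indic (Blocks r W z u)) * (1 - indic (Blocks r W z v)) *
      (1 - indic (Blocks r W z w)) =
      1 - indic (Blocks r W z u) - indic (Blocks r W z v) - indic (Blocks r W z w) := by
    intro z _
    have huw : r u w v := hr.swap_right huvw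
    have hvw : r v w u := hr.rot _ _ _ huvw
    have n1 := fun h h' => hP.not_blocks_of_edge (z := z) hr hv hw huvw h h'
    have n2 := fun h h' => hP.not_blocks_of_edge (z := z) hr hw hv huw h h'
    have n3 := fun h h' => hP.not_blocks_of_edge (z := z) hr hw hu hvw h h'
    unfold indic
    split_ifs <;> first | (exfalso; tauto) | norm_num
  have hs : ∑ z ∈ A, δ * Ω z * ((1 - indic (Blocks r W z u)) * (1 - indic (Blocks r W z v)) *
      (1 - indic (Blocks r W z w)) * (Ω u * Ω v * Ω w * 1)) =
      Ω u * Ω v * Ω w * (δ * Y - δ * hazard r W A Ω u - δ * hazard r W A Ω v -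
        δ * hazard r W A Ω w) := by
    simp only [hY, poolWeight, hazard, Finset.mul_sum, ← Finset.sum_sub_distrib]
    refine Finset.sum_congr rfl fun z hz => ?_
    rw [hd z hz]; ring
  rw [hs]
  simp only [weightIdle]
  have ha := mul_nonneg hδ (hP.hazard_nonneg u)
  have hb := mul_nonneg hδ (hP.hazard_nonneg v)
  have hc := mul_nonneg hδ (hP.hazard_nonneg w)
  have hal := mul_le_mul_of_nonneg_left (hP.hazard_le u) hδ
  have hbl := mul_le_mul_of_nonneg_left (hP.hazard_le v) hδ
  have hcl := mul_le_mul_of_nonneg_left (hP.hazard_le w) hδ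
  rw [← hY] at hal hbl hcl
  have hw0 := mul_nonneg (mul_nonneg (hΩ u hu) (hΩ v hv)) (hΩ w hw)
  set a := δ * hazard r W A Ω u
  set b := δ * hazard r W A Ω v
  set c := δ * hazard r W A Ω w
  set l := δ * Y
  have key : (l - a - b - c) + (1 - l) * ((1 + a) * (1 + b) * (1 + c)) ≤ 1 := by
    have i1 : a * b ≤ l * b := mul_le_mul_of_nonneg_right hal hb
    have i2 : b * c ≤ l * c := mul_le_mul_of_nonneg_right hbl hc
    have i3 : a * c ≤ a * l := mul_le_mul_of_nonneg_left hcl ha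
    have i4 : a * b * c ≤ a * b * l := mul_le_mul_of_nonneg_left hcl (mul_nonneg ha hb)
    have l0 : 0 ≤ l := ha.trans hal
    have i5 : 0 ≤ l * (b * c) := by positivity
    have i6 : 0 ≤ l * (a * c) := by positivity
    have i7 : 0 ≤ l * (a * b * c) := by positivity
    nlinarith
  calc _ = Ω u * Ω v * Ω w * ((l - a - b - c) + (1 - l) * ((1 + a) * (1 + b) * (1 + c))) := by
        ring
    _ ≤ Ω u * Ω v * Ω w * 1 := mul_le_mul_of_nonneg_left key hw0

theorem stepMean_pairWeight_le [DecidableEq V] (hr : IsUncrowded r) (hP : IsPartial r M W A Ω)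
    {δ : ℝ} (hδ : 0 ≤ δ) (hδA : δ * poolWeight A Ω ≤ 1) :
    stepMean δ A Ω (fun z => pairWeight r (insert z W) (poolAfter r W A z) Ω)
        (pairWeight r W (poolIdle r M δ W A Ω) (weightIdle r δ W A Ω)) ≤
      (1 + 2 * δ * M) * pairWeight r W A Ω + δ * tripleWeight r A Ω := by
  set Y := poolWeight A Ω with hY
  have hΩ := fun v (hv : v ∈ A) => (hP.pos hv).le
  have hΩ' := fun v (hv : v ∈ A) => hP.weightIdle_nonneg hδ hv
  have h1 : ∑ z ∈ A, δ * Ω z * pairWeight r (insert z W) (poolAfter r W A z) Ω ≤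
      ∑ u ∈ A, ∑ w ∈ A, ∑ z ∈ A, δ * Ω z * ((1 - indic (Blocks r W z u)) *
        (1 - indic (Blocks r W z w)) * (Ω u * Ω w * indic (∃ p ∈ W, r p u w))) +
      δ * tripleWeight r A Ω := by
    have : ∀ z ∈ A, δ * Ω z * pairWeight r (insert z W) (poolAfter r W A z) Ω ≤
        ∑ u ∈ A, ∑ w ∈ A, δ * Ω z * ((1 - indic (Blocks r W z u)) *
        (1 - indic (Blocks r W z w)) * (Ω u * Ω w * indic (∃ p ∈ W, r p u w))) +
        δ * ∑ u ∈ A, ∑ w ∈ A, Ω z * Ω u * Ω w * indic (r z u w) := by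
      intro z hz
      rw [pairWeight]
      simp only [sum_poolAfter, Finset.mul_sum, ← Finset.sum_add_distrib]
      refine Finset.sum_le_sum fun u hu => Finset.sum_le_sum fun w hw => ?_
      have hi : indic (∃ p ∈ insert z W, r p u w) ≤ indic (∃ p ∈ W, r p u w) + indic (r z u w) :=
        (indic_mono (by simp only [Finset.mem_insert]; aesop)).trans (indic_or_le _ _)
      have b1 := indic_nonneg (Blocks r W z u)
      have b2 := indic_nonneg (Blocks r W z w)
      have b3 := indic_le_one (Blocks r W z u)
      have b4 := indic_le_one (Blocks r W z w)
      set x := indic (Blocks r W z u)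
      set y := indic (Blocks r W z w)
      have g0 : 0 ≤ δ * Ω z * (Ω u * Ω w) :=
        mul_nonneg (mul_nonneg hδ (hΩ z hz)) (mul_nonneg (hΩ u hu) (hΩ w hw))
      have g1 : 0 ≤ (1 - x) * (1 - y) := mul_nonneg (by linarith) (by linarith)
      have g2 : (1 - x) * (1 - y) ≤ 1 := by nlinarith
      have g3 := indic_nonneg (r z u w)
      calc _ = δ * Ω z * (Ω u * Ω w) * (((1 - x) * (1 - y)) *
            indic (∃ p ∈ insert z W, r p u w)) := by ring
        _ ≤ δ * Ω z * (Ω u * Ω w) * (((1 - x) * (1 - y)) * indic (∃ p ∈ W, r p u w) +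
            indic (r z u w)) := by
            refine mul_le_mul_of_nonneg_left ?_ g0
            nlinarith [mul_le_mul_of_nonneg_left hi g1, mul_le_mul_of_nonneg_right g2 g3]
        _ = _ := by ring
    refine (Finset.sum_le_sum this).trans ?_
    rw [Finset.sum_add_distrib, ← Finset.mul_sum]
    refine add_le_add_left (le_of_eq ?_) _
    rw [Finset.sum_comm]
    refine Finset.sum_congr rfl fun u _ => ?_
    rw [Finset.sum_comm]
  have h2 : pairWeight r W (poolIdle r M δ W A Ω) (weightIdle r δ W A Ω) ≤
      pairWeight r W A (weightIdle r δ W A Ω) := by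
    have nn : ∀ u ∈ A, ∀ w ∈ A, 0 ≤ weightIdle r δ W A Ω u * weightIdle r δ W A Ω w *
        indic (∃ p ∈ W, r p u w) := fun u hu w hw =>
      mul_nonneg (mul_nonneg (hΩ' u hu) (hΩ' w hw)) (indic_nonneg _)
    have hsub : poolIdle r M δ W A Ω ⊆ A := Finset.filter_subset _ _
    rw [pairWeight, pairWeight]
    calc _ ≤ ∑ u ∈ poolIdle r M δ W A Ω, ∑ w ∈ A, weightIdle r δ W A Ω u *
          weightIdle r δ W A Ω w * indic (∃ p ∈ W, r p u w) :=
          Finset.sum_le_sum fun u hu => sum_filter_le_sum A _ fun w hw => nn u (hsub hu) w hw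
      _ ≤ _ := sum_filter_le_sum A _ fun u hu => Finset.sum_nonneg fun w hw => nn u hu w hw
  rw [stepMean]
  have h3 := mul_le_mul_of_nonneg_left h2 (by linarith : 0 ≤ 1 - δ * Y)
  suffices h4 : ∑ u ∈ A, ∑ w ∈ A, ∑ z ∈ A, δ * Ω z * ((1 - indic (Blocks r W z u)) *
        (1 - indic (Blocks r W z w)) * (Ω u * Ω w * indic (∃ p ∈ W, r p u w))) +
      (1 - δ * Y) * pairWeight r W A (weightIdle r δ W A Ω) ≤
      (1 + 2 * δ * M) * pairWeight r W A Ω by linarith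
  rw [pairWeight, pairWeight, Finset.mul_sum, Finset.mul_sum, ← Finset.sum_add_distrib]
  refine Finset.sum_le_sum fun u hu => ?_
  rw [Finset.mul_sum, Finset.mul_sum, ← Finset.sum_add_distrib]
  refine Finset.sum_le_sum fun w hw => ?_
  by_cases huw : ∃ p ∈ W, r p u w
  swap
  · simp [indic_of_false huw]
  rw [indic_of_true huw]
  have hs : ∑ z ∈ A, δ * Ω z * ((1 - indic (Blocks r W z u)) * (1 - indic (Blocks r W z w)) *
      (Ω u * Ω w * 1)) ≤
      Ω u * Ω w * (δ * Y - δ * hazard r W A Ω u - δ * hazard r W A Ω w + 2 * δ * M) := by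
    have e : ∑ z ∈ A, δ * Ω z * (indic (z = u) + indic (z = w)) ≤ 2 * δ * M := by
      have : ∀ x ∈ A, ∑ z ∈ A, δ * Ω z * indic (z = x) = δ * Ω x := by
        intro x hx
        rw [Finset.sum_eq_single_of_mem x hx]
        · rw [indic_of_true rfl, mul_one]
        · intro z _ hzx; rw [indic_of_false hzx, mul_zero]
      simp only [mul_add, Finset.sum_add_distrib]
      rw [this u hu, this w hw]
      nlinarith [hP.le_top u hu, hP.le_top w hw]
    calc _ ≤ ∑ z ∈ A, Ω u * Ω w * (δ * Ω z - δ * (Ω z * indic (Blocks r W z u)) -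
          δ * (Ω z * indic (Blocks r W z w)) + δ * Ω z * (indic (z = u) + indic (z = w))) := by
          refine Finset.sum_le_sum fun z hz => ?_
          have hb : indic (Blocks r W z u) * indic (Blocks r W z w) ≤
              indic (z = u) + indic (z = w) := by
            have := fun h h' => hP.blocks_pair (z := z) hr hw huw h h'
            by_cases h : Blocks r W z u
            · by_cases h' : Blocks r W z w
              · rw [indic_of_true h, indic_of_true h', one_mul]
                exact (indic_of_true (this h h')).symm.le.trans (indic_or_le _ _)
              · rw [indic_of_false h', mul_zero]
                exact add_nonneg (indic_nonneg _) (indic_nonneg _)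
            · rw [indic_of_false h, zero_mul]
              exact add_nonneg (indic_nonneg _) (indic_nonneg _)
          have g0 : 0 ≤ δ * Ω z * (Ω u * Ω w) :=
            mul_nonneg (mul_nonneg hδ (hΩ z hz)) (mul_nonneg (hΩ u hu) (hΩ w hw))
          nlinarith [mul_le_mul_of_nonneg_left hb g0]
      _ = Ω u * Ω w * (δ * Y - δ * hazard r W A Ω u - δ * hazard r W A Ω w +
          ∑ z ∈ A, δ * Ω z * (indic (z = u) + indic (z = w))) := by
          rw [← Finset.mul_sum]
          simp only [Finset.sum_add_distrib, Finset.sum_sub_distrib, hY, poolWeight, hazard,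
            Finset.mul_sum]
      _ ≤ _ := mul_le_mul_of_nonneg_left (by linarith) (mul_nonneg (hΩ u hu) (hΩ w hw))
  refine (add_le_add_left hs _).trans ?_
  simp only [weightIdle]
  have ha := mul_nonneg hδ (hP.hazard_nonneg u)
  have hb := mul_nonneg hδ (hP.hazard_nonneg w)
  have hal := mul_le_mul_of_nonneg_left (hP.hazard_le u) hδ
  have hbl := mul_le_mul_of_nonneg_left (hP.hazard_le w) hδ
  rw [← hY] at hal hbl
  have hw0 := mul_nonneg (hΩ u hu) (hΩ w hw)
  set a := δ * hazard r W A Ω u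
  set b := δ * hazard r W A Ω w
  set l := δ * Y
  have key : (l - a - b) + (1 - l) * ((1 + a) * (1 + b)) ≤ 1 := by
    have i1 : a * b ≤ l * b := mul_le_mul_of_nonneg_right hal hb
    have l0 : 0 ≤ l := ha.trans hal
    have i2 : 0 ≤ l * a := by positivity
    have i3 : 0 ≤ l * (a * b) := by positivity
    nlinarith
  calc _ = Ω u * Ω w * ((l - a - b) + (1 - l) * ((1 + a) * (1 + b)) + 2 * δ * M) := by ring
    _ ≤ Ω u * Ω w * (1 + 2 * δ * M) := mul_le_mul_of_nonneg_left (by linarith) hw0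
    _ = _ := by ring

theorem IsPartial.select [DecidableEq V] (hr : IsUncrowded r) (hP : IsPartial r M W A Ω) {z : V}
    (hz : z ∈ A) : IsPartial r M (insert z W) (poolAfter r W A z) Ω := by
  have hmem : ∀ v, v ∈ poolAfter r W A z ↔ v ∈ A ∧ ¬Blocks r W z v := by
    intro v; simp [poolAfter]
  have hne : ∀ a b, ¬r a a b := fun a b h => hr.ne _ _ _ h rfl
  have hne' : ∀ a b, ¬r a b b := fun a b h => hr.ne _ _ _ (hr.rot _ _ _ h) rfl
  have hne'' : ∀ a b, ¬r a b a := fun a b h => hr.ne _ _ _ (hr.swap_right h) rfl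
  refine ⟨?_, ?_, ?_, fun v hv => hP.one_le v ((hmem v).1 hv).1,
    fun v hv => hP.le_top v ((hmem v).1 hv).1⟩
  · intro v hv hvW
    rw [hmem] at hv
    rcases Finset.mem_insert.1 hvW with rfl | h
    · exact hv.2 (Or.inl rfl)
    · exact hP.disj v hv.1 h
  · intro a ha b hb c hc h
    rcases Finset.mem_insert.1 ha with rfl | ha' <;>
      rcases Finset.mem_insert.1 hb with rfl | hb' <;>
      rcases Finset.mem_insert.1 hc with rfl | hc'
    · exact hne _ _ h
    · exact hne _ _ h
    · exact hne'' _ _ h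
    · exact hP.avail b hb' c hc' _ hz (hr.rot _ _ _ h)
    · exact hne' _ _ h
    · exact hP.avail a ha' c hc' _ hz (hr.swap_right h)
    · exact hP.avail a ha' b hb' _ hz h
    · exact hP.indep a ha' b hb' c hc' h
  · intro a ha b hb c hc h
    rw [hmem] at hc
    rcases Finset.mem_insert.1 ha with rfl | ha' <;>
      rcases Finset.mem_insert.1 hb with rfl | hb'
    · exact hne _ _ h
    · exact hc.2 (Or.inr ⟨b, hb', hr.swap _ _ _ h⟩)
    · exact hc.2 (Or.inr ⟨a, ha', h⟩)
    · exact hP.avail a ha' b hb' c hc.1 h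

theorem poolAfter_subset (r : V → V → V → Prop) (W A : Finset V) (z : V) :
    poolAfter r W A z ⊆ A := by
  classical exact Finset.filter_subset _ _

theorem poolIdle_subset (r : V → V → V → Prop) (M δ : ℝ) (W A : Finset V) (Ω : V → ℝ) :
    poolIdle r M δ W A Ω ⊆ A := by
  classical exact Finset.filter_subset _ _

theorem IsPartial.idle (hP : IsPartial r M W A Ω) {δ : ℝ} (hδ : 0 ≤ δ) :
    IsPartial r M W (poolIdle r M δ W A Ω) (weightIdle r δ W A Ω) := by
  have hmem : ∀ v, v ∈ poolIdle r M δ W A Ω ↔ v ∈ A ∧ weightIdle r δ W A Ω v ≤ M := by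
    intro v; simp [poolIdle, weightIdle]
  refine ⟨fun v hv => hP.disj v ((hmem v).1 hv).1, hP.indep,
    fun a ha b hb c hc => hP.avail a ha b hb c ((hmem c).1 hc).1, fun v hv => ?_,
    fun v hv => ((hmem v).1 hv).2⟩
  have h1 := hP.one_le v ((hmem v).1 hv).1
  rw [weightIdle]
  nlinarith [mul_nonneg hδ (hP.hazard_nonneg v)]

theorem IsPartial.removalRate_le (hr : IsUncrowded r) (hP : IsPartial r M W A Ω) :
    removalRate r W A Ω ≤ M * poolWeight A Ω + pairWeight r W A Ω := by
  rw [removalRate, poolWeight, pairWeight, Finset.mul_sum, ← Finset.sum_add_distrib]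
  refine Finset.sum_le_sum fun v hv => ?_
  have e : hazard r W A Ω v ≤ Ω v + ∑ u ∈ A, Ω u * indic (∃ p ∈ W, r p v u) := by
    have : ∑ u ∈ A, Ω u * indic (u = v) = Ω v := by
      rw [Finset.sum_eq_single_of_mem v hv]
      · rw [indic_of_true rfl, mul_one]
      · intro z _ hzx; rw [indic_of_false hzx, mul_zero]
    rw [← this, ← Finset.sum_add_distrib]
    refine Finset.sum_le_sum fun u hu => ?_
    rw [← mul_add]
    refine mul_le_mul_of_nonneg_left ?_ (hP.pos hu).le
    refine (indic_mono ?_).trans (indic_or_le _ _)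
    rintro (h | ⟨p, hp, h⟩)
    · exact Or.inl h
    · exact Or.inr ⟨p, hp, hr.swap_right h⟩
  calc Ω v * hazard r W A Ω v
      ≤ Ω v * (Ω v + ∑ u ∈ A, Ω u * indic (∃ p ∈ W, r p v u)) :=
        mul_le_mul_of_nonneg_left e (hP.pos hv).le
    _ = Ω v * Ω v + ∑ u ∈ A, Ω v * Ω u * indic (∃ p ∈ W, r p v u) := by
        rw [mul_add, Finset.mul_sum]; simp only [mul_assoc]
    _ ≤ _ := by nlinarith [hP.le_top v hv, hP.pos hv]

theorem IsPartial.removalRate_le_sq (hP : IsPartial r M W A Ω) :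
    removalRate r W A Ω ≤ poolWeight A Ω ^ 2 := by
  rw [sq, removalRate]
  nth_rw 1 [poolWeight]
  rw [Finset.sum_mul]
  exact Finset.sum_le_sum fun v hv => mul_le_mul_of_nonneg_left (hP.hazard_le v) (hP.pos hv).le

theorem stepMean_le {δ K : ℝ} {f : V → ℝ} {f₀ : ℝ} (hP : IsPartial r M W A Ω) (hδ : 0 ≤ δ)
    (hδA : δ * poolWeight A Ω ≤ 1) (hf : ∀ z ∈ A, f z ≤ K) (hf₀ : f₀ ≤ K) :
    stepMean δ A Ω f f₀ ≤ K := by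
  have h1 : ∑ z ∈ A, δ * Ω z * f z ≤ δ * poolWeight A Ω * K := by
    rw [poolWeight, Finset.mul_sum, Finset.sum_mul]
    exact Finset.sum_le_sum fun z hz =>
      mul_le_mul_of_nonneg_left (hf z hz) (mul_nonneg hδ (hP.pos hz).le)
  have h2 := mul_le_mul_of_nonneg_left hf₀ (by linarith : 0 ≤ 1 - δ * poolWeight A Ω)
  rw [stepMean]; linarith

/-- Potential function bound: with `j` steps of length `δ` left, the selected set together with the
expected future selections, discounted by the weights of the obstructions, does not exceed the
independence number. -/
theorem potential_le [DecidableEq V] (hr : IsUncrowded r) {S : Finset V} {K δ β : ℝ}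
    (hK : ∀ I ⊆ S, (∀ a ∈ I, ∀ b ∈ I, ∀ c ∈ I, ¬r a b c) → (I.card : ℝ) ≤ K)
    (hM : 1 < M) (hδ : 0 ≤ δ) (hβ : 0 ≤ β) (hβM : β * M ≤ 1) (hS : δ * (S.card * M) ≤ 1) (j : ℕ)
    (hj : 4 * (j * δ) * M ≤ 1) (hjβ : j * δ ≤ β * Real.log M)
    (hP : IsPartial r M W A Ω) (hW : W ⊆ S) (hA : A ⊆ S) :
    W.card + j * δ * (1 - β * M) * poolWeight A Ω - β * logWeight A Ω -
      2 * β * (j * δ) * pairWeight r W A Ω - β * (j * δ) ^ 2 * tripleWeight r A Ω -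
      j * δ ^ 2 * (β * Real.log M) * (S.card * M) ^ 3 ≤ K := by
  induction j generalizing W A Ω with
  | zero =>
    have h1 : (W.card : ℝ) ≤ K := hK W hW hP.indep
    have h2 : 0 ≤ logWeight A Ω := Finset.sum_nonneg fun v hv =>
      mul_nonneg (hP.pos hv).le (Real.log_nonneg (hP.one_le v hv))
    have := mul_nonneg hβ h2
    simp only [Nat.cast_zero, zero_mul, mul_zero]
    simp
    linarith
  | succ j ih =>
    push_cast at hj hjβ ⊢
    have hM0 : 0 < M := one_pos.trans hM
    have hjn : (0 : ℝ) ≤ j := j.cast_nonneg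
    have hlog : 0 < Real.log M := Real.log_pos hM
    have hδM : 0 ≤ δ * M := mul_nonneg hδ hM0.le
    have ih' := fun {W A Ω} => ih (W := W) (A := A) (Ω := Ω) (by nlinarith) (by nlinarith)
    have hYS : poolWeight A Ω ≤ S.card * M := hP.poolWeight_le.trans
      (mul_le_mul_of_nonneg_right (by exact_mod_cast Finset.card_le_card hA) hM0.le)
    have hY0 := hP.poolWeight_nonneg
    have hδA : δ * poolWeight A Ω ≤ 1 := (mul_le_mul_of_nonneg_left hYS hδ).trans hS
    set C := (S.card * M) ^ 3 with hC
    set Λ := Real.log M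
    have main := stepMean_le (K := K - W.card) hP hδ hδA
      (f := fun z => 1 + j * δ * (1 - β * M) * poolWeight (poolAfter r W A z) Ω -
        β * logWeight (poolAfter r W A z) Ω -
        2 * β * (j * δ) * pairWeight r (insert z W) (poolAfter r W A z) Ω -
        β * (j * δ) ^ 2 * tripleWeight r (poolAfter r W A z) Ω - j * δ ^ 2 * (β * Λ) * C)
      (f₀ := j * δ * (1 - β * M) * poolWeight (poolIdle r M δ W A Ω) (weightIdle r δ W A Ω) -
        β * logWeight (poolIdle r M δ W A Ω) (weightIdle r δ W A Ω) -
        2 * β * (j * δ) * pairWeight r W (poolIdle r M δ W A Ω) (weightIdle r δ W A Ω) -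
        β * (j * δ) ^ 2 * tripleWeight r (poolIdle r M δ W A Ω) (weightIdle r δ W A Ω) -
        j * δ ^ 2 * (β * Λ) * C)
      (fun z hz => by
        have := ih' (hP.select hr hz)
          (Finset.insert_subset (hA hz) hW) ((poolAfter_subset _ _ _ _).trans hA)
        rw [Finset.card_insert_of_notMem (hP.disj z hz)] at this
        push_cast at this
        linarith)
      (by
        have := ih' (hP.idle hδ) hW ((poolIdle_subset _ _ _ _ _ _).trans hA)
        linarith)
    have lin : ∀ (f₁ f₂ f₃ f₄ : V → ℝ) (g₁ g₂ g₃ g₄ a b c d e : ℝ),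
        stepMean δ A Ω (fun z => 1 + a * f₁ z - b * f₂ z - c * f₃ z - d * f₄ z - e)
          (a * g₁ - b * g₂ - c * g₃ - d * g₄ - e) =
        δ * poolWeight A Ω + a * stepMean δ A Ω f₁ g₁ - b * stepMean δ A Ω f₂ g₂ -
          c * stepMean δ A Ω f₃ g₃ - d * stepMean δ A Ω f₄ g₄ - e := by
      intro f₁ f₂ f₃ f₄ g₁ g₂ g₃ g₄ a b c d e
      have : ∑ z ∈ A, δ * Ω z * (1 + a * f₁ z - b * f₂ z - c * f₃ z - d * f₄ z - e) =
          (1 - e) * (δ * ∑ z ∈ A, Ω z) + a * ∑ z ∈ A, δ * Ω z * f₁ z -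
          b * ∑ z ∈ A, δ * Ω z * f₂ z - c * ∑ z ∈ A, δ * Ω z * f₃ z -
          d * ∑ z ∈ A, δ * Ω z * f₄ z := by
        simp only [Finset.mul_sum, ← Finset.sum_add_distrib, ← Finset.sum_sub_distrib]
        exact Finset.sum_congr rfl fun z _ => by ring
      simp only [stepMean, this, poolWeight]; ring
    rw [lin, stepMean_poolWeight] at main
    have hL := stepMean_logWeight_le hP hδ hδA hM0
    have hQ := stepMean_pairWeight_le hr hP hδ hδA
    have hR := stepMean_tripleWeight_le hr hP hδ hδA
    have hrem := hP.removalRate_le hr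
    have hrem2 : poolWeight A Ω * removalRate r W A Ω ≤ C := by
      calc _ ≤ poolWeight A Ω * poolWeight A Ω ^ 2 :=
            mul_le_mul_of_nonneg_left hP.removalRate_le_sq hY0
        _ = poolWeight A Ω ^ 3 := by ring
        _ ≤ C := pow_le_pow_left₀ hY0 hYS 3
    have hloss : 0 ≤ (1 - δ * poolWeight A Ω) * lossIdle r M δ W A Ω :=
      mul_nonneg (by linarith) (Finset.sum_nonneg fun v hv =>
        mul_nonneg (indic_nonneg _) (hP.weightIdle_nonneg hδ hv))
    have hQ0 : 0 ≤ pairWeight r W A Ω := Finset.sum_nonneg fun u hu => Finset.sum_nonneg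
      fun w hw => mul_nonneg (mul_nonneg (hP.pos hu).le (hP.pos hw).le) (indic_nonneg _)
    have hR0 : 0 ≤ tripleWeight r A Ω := Finset.sum_nonneg fun u hu => Finset.sum_nonneg
      fun v hv => Finset.sum_nonneg fun w hw => mul_nonneg (mul_nonneg (mul_nonneg (hP.pos hu).le
        (hP.pos hv).le) (hP.pos hw).le) (indic_nonneg _)
    set Y := poolWeight A Ω
    set L := logWeight A Ω
    set Q := pairWeight r W A Ω
    set R := tripleWeight r A Ω
    set X := removalRate r W A Ω
    set ℓ := (1 - δ * Y) * lossIdle r M δ W A Ω with hℓ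
    set a := j * δ * (1 - β * M) with ha
    have hjδ : 0 ≤ j * δ := mul_nonneg hjn hδ
    have ha0 : 0 ≤ a := mul_nonneg hjδ (by linarith)
    have haΛ : a ≤ β * Λ := by nlinarith [mul_nonneg hjδ (mul_nonneg hβ hM0.le)]
    have t1 : a * (δ ^ 2 * Y * X) ≤ δ ^ 2 * (β * Λ) * C := by
      calc a * (δ ^ 2 * Y * X) = a * δ ^ 2 * (Y * X) := by ring
        _ ≤ a * δ ^ 2 * C := mul_le_mul_of_nonneg_left hrem2 (mul_nonneg ha0 (sq_nonneg _))
        _ ≤ (β * Λ) * δ ^ 2 * C := mul_le_mul_of_nonneg_right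
            (mul_le_mul_of_nonneg_right haΛ (sq_nonneg _)) (by positivity)
        _ = _ := by ring
    have t2 : a * ℓ ≤ β * Λ * ℓ := mul_le_mul_of_nonneg_right haΛ hloss
    have t3 := mul_le_mul_of_nonneg_left hL hβ
    have t4 := mul_le_mul_of_nonneg_left hrem (mul_nonneg hβ hδ)
    have t5 := mul_le_mul_of_nonneg_left hQ (mul_nonneg (mul_nonneg zero_le_two hβ) hjδ)
    have t6 := mul_le_mul_of_nonneg_left hR (mul_nonneg hβ (sq_nonneg (j * δ)))
    have t7 : 4 * (j * δ) * M * (β * δ * Q) ≤ 1 * (β * δ * Q) :=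
      mul_le_mul_of_nonneg_right (by nlinarith) (by positivity)
    have t8 : 0 ≤ β * δ ^ 2 * R := by positivity
    have e1 : β * (L + δ * X - (1 - δ * Y) * (Λ * lossIdle r M δ W A Ω)) =
        β * L + β * δ * X - β * Λ * ℓ := by rw [hℓ]; ring
    rw [e1] at t3
    have e2 : a * (Y - δ ^ 2 * Y * X - ℓ) = a * Y - a * (δ ^ 2 * Y * X) - a * ℓ := by ring
    rw [e2] at main
    have e3 : (j + 1) * δ * (1 - β * M) * Y = a * Y + δ * Y - β * δ * (M * Y) := by
      rw [ha]; ring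
    rw [e3]
    linarith

end Nibble

/-- A lower bound for the independence number of an uncrowded hypergraph. -/
theorem IsUncrowded.le_of_forall_card_le {V : Type*} {r : V → V → V → Prop} (hr : IsUncrowded r)
    {S : Finset V} {K M T : ℝ}
    (hK : ∀ I ⊆ S, (∀ a ∈ I, ∀ b ∈ I, ∀ c ∈ I, ¬r a b c) → (I.card : ℝ) ≤ K)
    (hM : 1 < M) (hT : 0 < T) (hTM : 4 * T * M ≤ 1) (hTlog : 2 * (T * M) ≤ Real.log M) :
    T / 2 * S.card - T ^ 3 / Real.log M * ∑ a ∈ S, ∑ b ∈ S, ∑ c ∈ S, indic (r a b c) ≤ K := by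
  classical
  have hlog : 0 < Real.log M := Real.log_pos hM
  have hM0 : 0 < M := one_pos.trans hM
  refine le_of_forall_pos_le_add fun ε hε => ?_
  set C := (S.card * M) ^ 3 with hC
  have hC0 : 0 ≤ C := by positivity
  obtain ⟨m, hm⟩ := exists_nat_ge (T * (S.card * M) + T ^ 3 * C / ε + 1)
  have h1 : 0 ≤ T * (S.card * M) := by positivity
  have h2 : 0 ≤ T ^ 3 * C / ε := by positivity
  have hm0 : (0 : ℝ) < m := by linarith
  have hmT : (m : ℝ) * (T / m) = T := by field_simp
  have hP : IsPartial r M ∅ S (fun _ => 1) :=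
    ⟨by simp, by simp, by simp, fun _ _ => le_rfl, fun _ _ => hM.le⟩
  have hβM : T / Real.log M * M ≤ 1 / 2 := by
    rw [div_mul_eq_mul_div, div_le_iff₀ hlog]; linarith
  have hβlog : T / Real.log M * Real.log M = T := by field_simp
  have key := potential_le (δ := T / m) (β := T / Real.log M) hr hK hM (by positivity)
    (by positivity) (by linarith)
    (by rw [div_mul_eq_mul_div, div_le_one hm0]; linarith) m (by rw [hmT]; exact hTM)
    (by rw [hmT, hβlog]) hP (Finset.empty_subset _) subset_rfl
  have e1 : poolWeight S (fun _ => (1 : ℝ)) = S.card := by simp [poolWeight]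
  have e2 : logWeight S (fun _ => (1 : ℝ)) = 0 := by simp [logWeight]
  have e3 : pairWeight r ∅ S (fun _ => (1 : ℝ)) = 0 := by simp [pairWeight, indic]
  have e4 : tripleWeight r S (fun _ => (1 : ℝ)) =
      ∑ a ∈ S, ∑ b ∈ S, ∑ c ∈ S, indic (r a b c) := by simp [tripleWeight]
  rw [e1, e2, e3, e4, hβlog, hmT, ← hC] at key
  have e5 : (m : ℝ) * (T / m) ^ 2 * T * C ≤ ε := by
    have : (m : ℝ) * (T / m) ^ 2 * T * C = T ^ 3 * C / m := by field_simp
    rw [this, div_le_iff₀ hm0]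
    have : T ^ 3 * C / ε ≤ m := by linarith
    rw [div_le_iff₀ hε] at this
    linarith
  have e6 : T / 2 * (S.card : ℝ) ≤ T * (1 - T / Real.log M * M) * S.card := by
    refine mul_le_mul_of_nonneg_right ?_ (Nat.cast_nonneg _)
    nlinarith
  have e7 : T / Real.log M * T ^ 2 = T ^ 3 / Real.log M := by ring
  rw [e7] at key
  simp only [Finset.card_empty, Nat.cast_zero] at key
  linarith

section Sampling

variable {V : Type*}

/-- The mean of `f` over a random subset of `U` containing each element independently with
probability `p`. -/
def subsetMean (p : ℝ) (U : Finset V) (f : Finset V → ℝ) : ℝ :=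
  ∑ R ∈ U.powerset, p ^ R.card * (1 - p) ^ (U.card - R.card) * f R

variable {p : ℝ} {U : Finset V}

theorem subsetMean_mono (hp : 0 ≤ p) (hp1 : p ≤ 1) {f g : Finset V → ℝ}
    (h : ∀ R ⊆ U, f R ≤ g R) : subsetMean p U f ≤ subsetMean p U g :=
  Finset.sum_le_sum fun R hR => mul_le_mul_of_nonneg_left (h R (Finset.mem_powerset.1 hR))
    (mul_nonneg (pow_nonneg hp _) (pow_nonneg (by linarith) _))

theorem subsetMean_add (f g : Finset V → ℝ) :
    subsetMean p U (fun R => f R + g R) = subsetMean p U f + subsetMean p U g := by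
  simp only [subsetMean, mul_add, Finset.sum_add_distrib]

theorem subsetMean_const_mul (a : ℝ) (f : Finset V → ℝ) :
    subsetMean p U (fun R => a * f R) = a * subsetMean p U f := by
  simp only [subsetMean, Finset.mul_sum]
  exact Finset.sum_congr rfl fun R _ => by ring

theorem subsetMean_sum {ι : Type*} (s : Finset ι) (f : ι → Finset V → ℝ) :
    subsetMean p U (fun R => ∑ i ∈ s, f i R) = ∑ i ∈ s, subsetMean p U (f i) := by
  simp only [subsetMean, Finset.mul_sum]
  exact Finset.sum_comm

theorem subsetMean_const (a : ℝ) : subsetMean p U (fun _ => a) = a := by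
  rw [subsetMean, ← Finset.sum_mul, Finset.sum_pow_mul_eq_add_pow]
  simp

variable [DecidableEq V]

theorem subsetMean_superset {B : Finset V} (hB : B ⊆ U) :
    subsetMean p U (fun R => if B ⊆ R then 1 else 0) = p ^ B.card := by
  have h := Finset.prod_add (fun _ => p) (fun i => if i ∈ B then 0 else 1 - p) U
  have e1 : ∏ i ∈ U, (p + if i ∈ B then 0 else 1 - p) = p ^ B.card := by
    rw [← Finset.prod_sdiff hB, Finset.prod_congr rfl (g := fun _ => (1 : ℝ)),
      Finset.prod_congr (s₁ := B) rfl (g := fun _ => p)]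
    · simp
    · intro i hi; simp [hi]
    · intro i hi; simp [(Finset.mem_sdiff.1 hi).2]
  rw [← e1, h, subsetMean]
  refine Finset.sum_congr rfl fun R hR => ?_
  rw [Finset.mem_powerset] at hR
  rw [Finset.prod_const, mul_assoc]
  congr 1
  split_ifs with hBR
  · rw [Finset.prod_congr rfl (g := fun _ => 1 - p), Finset.prod_const,
      Finset.card_sdiff_of_subset hR, mul_one]
    intro i hi
    rw [if_neg fun h => (Finset.mem_sdiff.1 hi).2 (hBR h)]
  · obtain ⟨i, hi, hiR⟩ := Finset.not_subset.1 hBR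
    rw [mul_zero]
    symm
    exact Finset.prod_eq_zero (Finset.mem_sdiff.2 ⟨hB hi, hiR⟩) (by rw [if_pos hi])

theorem subsetMean_card : subsetMean p U (fun R => (R.card : ℝ)) = p * U.card := by
  have : subsetMean p U (fun R => (R.card : ℝ)) =
      subsetMean p U (fun R => ∑ v ∈ U, if {v} ⊆ R then 1 else 0) := by
    refine Finset.sum_congr rfl fun R hR => ?_
    rw [Finset.mem_powerset] at hR
    simp only [Finset.singleton_subset_iff, Finset.sum_boole]
    rw [Finset.filter_mem_eq_inter, Finset.inter_eq_right.2 hR]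
  rw [this, subsetMean_sum, Finset.sum_congr rfl (g := fun _ => p)]
  · simp [mul_comm]
  · intro v hv
    rw [subsetMean_superset (Finset.singleton_subset_iff.2 hv)]; simp

/-- The expected number of members of a family contained in a random subset. -/
theorem subsetMean_card_filter_le (F : Finset (Finset V)) {q : ℝ} (hq : ∀ B ∈ F, p ^ B.card ≤ q)
    (hq0 : 0 ≤ q) : subsetMean p U (fun R => ((F.filter (· ⊆ R)).card : ℝ)) ≤ F.card * q := by
  have : subsetMean p U (fun R => ((F.filter (· ⊆ R)).card : ℝ)) =
      subsetMean p U (fun R => ∑ B ∈ F, if B ⊆ R then 1 else 0) := by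
    simp only [Finset.sum_boole]
  rw [this, subsetMean_sum, ← nsmul_eq_mul]
  refine Finset.sum_le_card_nsmul _ _ _ fun B hB => ?_
  by_cases hBU : B ⊆ U
  · rw [subsetMean_superset hBU]; exact hq B hB
  · refine le_trans (le_of_eq ?_) hq0
    refine Finset.sum_eq_zero fun R hR => ?_
    have : ¬B ⊆ R := fun h => hBU (h.trans (Finset.mem_powerset.1 hR))
    simp [this]

/-- Deleting a vertex from each member of a family of nonempty sets. -/
theorem exists_subset_avoiding (F : Finset (Finset V)) (hF : ∀ B ∈ F, B.Nonempty) (R : Finset V) :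
    ∃ S ⊆ R, (∀ B ∈ F, ¬B ⊆ S) ∧ R.card ≤ S.card + (F.filter (· ⊆ R)).card := by
  rcases isEmpty_or_nonempty V with hV | hV
  · exact ⟨R, subset_rfl, fun B hB _ => hV.elim (hF B hB).choose, Nat.le_add_right _ _⟩
  choose! h hh using hF
  refine ⟨R \ (F.filter (· ⊆ R)).image h, Finset.sdiff_subset, fun B hB hBS => ?_, ?_⟩
  · have := Finset.mem_sdiff.1 (hBS (hh B hB))
    exact this.2 (Finset.mem_image_of_mem h
      (Finset.mem_filter.2 ⟨hB, hBS.trans Finset.sdiff_subset⟩))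
  · have h1 := Finset.le_card_sdiff ((F.filter (· ⊆ R)).image h) R
    have h2 := Finset.card_image_le (s := F.filter (· ⊆ R)) (f := h)
    omega

end Sampling

section Hypergraph

variable {V : Type*} [DecidableEq V]

/-- The ordered triples enumerating the edges of a hypergraph. -/
abbrev EdgeRel (E : Finset (Finset V)) (a b c : V) : Prop := ({a, b, c} : Finset V) ∈ E

theorem ne_of_edgeRel {E : Finset (Finset V)} (hE : ∀ A ∈ E, A.card = 3) {a b c : V}
    (h : EdgeRel E a b c) : a ≠ b ∧ a ≠ c ∧ b ≠ c := by
  have h3 := hE _ h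
  refine ⟨?_, ?_, ?_⟩ <;> rintro rfl
  · have := Finset.card_le_two (a := a) (b := c)
    rw [Finset.insert_eq_of_mem (Finset.mem_insert_self _ _)] at h3
    omega
  · have := Finset.card_le_two (a := b) (b := a)
    rw [Finset.insert_eq_of_mem (by simp)] at h3
    omega
  · have := Finset.card_le_two (a := a) (b := b)
    rw [Finset.pair_eq_singleton] at h3
    have := Finset.card_le_two (a := a) (b := b)
    omega

theorem EdgeRel.swap {E : Finset (Finset V)} {a b c : V} (h : EdgeRel E a b c) :
    EdgeRel E b a c := by
  unfold EdgeRel at *; rwa [Finset.insert_comm]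

theorem EdgeRel.rot {E : Finset (Finset V)} {a b c : V} (h : EdgeRel E a b c) :
    EdgeRel E b c a := by
  unfold EdgeRel at *
  rwa [show ({b, c, a} : Finset V) = {a, b, c} by ext; simp; tauto]

theorem isUncrowded_edgeRel {E : Finset (Finset V)} (hE : ∀ A ∈ E, A.card = 3)
    (h2 : ∀ a b c c', EdgeRel E a b c → EdgeRel E a b c' → c = c')
    (h3 : ∀ a b c x y z, EdgeRel E a b x → EdgeRel E b c y → EdgeRel E a c z →
      ({a, b, c, x, y, z} : Finset V).card ≠ 6) : IsUncrowded (EdgeRel E) where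
  swap _ _ _ h := h.swap
  rot _ _ _ h := h.rot
  ne _ _ _ h := (ne_of_edgeRel hE h).1
  linear := h2
  triangle a b c x y z hab hbc hac hx hy hz := by
    by_contra hcon
    have ex := ne_of_edgeRel hE hx
    have ey := ne_of_edgeRel hE hy
    have ez := ne_of_edgeRel hE hz
    have xc : x ≠ c := by rintro rfl; exact hcon hx
    have ya : y ≠ a := by rintro rfl; exact hcon hy.rot.rot
    have zb : z ≠ b := by rintro rfl; exact hcon hz.swap.rot
    have xy : x ≠ y := by rintro rfl; exact hac (h2 _ _ _ _ hx.rot hy.swap.rot)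
    have xz : x ≠ z := by rintro rfl; exact hbc (h2 _ _ _ _ hx.rot.rot hz.rot.rot)
    have yz : y ≠ z := by rintro rfl; exact hab.symm (h2 _ _ _ _ hy.rot hz.rot)
    refine h3 a b c x y z hx hy hz ?_
    rw [Finset.card_insert_of_notMem, Finset.card_insert_of_notMem,
      Finset.card_insert_of_notMem, Finset.card_insert_of_notMem, Finset.card_pair yz]
    all_goals simp only [Finset.mem_insert, Finset.mem_singleton, not_or]
    all_goals grind

theorem sum_indic_edgeRel_le (E : Finset (Finset V)) (hE : ∀ A ∈ E, A.card = 3) (S : Finset V) :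
    ∑ a ∈ S, ∑ b ∈ S, ∑ c ∈ S, indic (EdgeRel E a b c) ≤ 27 * (E.filter (· ⊆ S)).card := by
  have e : ∑ a ∈ S, ∑ b ∈ S, ∑ c ∈ S, indic (EdgeRel E a b c) =
      ((S ×ˢ S ×ˢ S).filter fun t => EdgeRel E t.1 t.2.1 t.2.2).card := by
    rw [Finset.card_filter, Finset.sum_product]
    push_cast
    refine Finset.sum_congr rfl fun a _ => ?_
    rw [Finset.sum_product]
    refine Finset.sum_congr rfl fun b _ => Finset.sum_congr rfl fun c _ => ?_
    simp only [indic]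
    split_ifs <;> rfl
  rw [e]
  have h : ((S ×ˢ S ×ˢ S).filter fun t => EdgeRel E t.1 t.2.1 t.2.2) ⊆
      (E.filter (· ⊆ S)).biUnion fun A => A ×ˢ A ×ˢ A := by
    rintro ⟨a, b, c⟩ ht
    simp only [Finset.mem_filter, Finset.mem_product] at ht
    refine Finset.mem_biUnion.2 ⟨{a, b, c}, Finset.mem_filter.2 ⟨ht.2, ?_⟩, by simp⟩
    intro v hv
    simp only [Finset.mem_insert, Finset.mem_singleton] at hv
    rcases hv with rfl | rfl | rfl
    exacts [ht.1.1, ht.1.2.1, ht.1.2.2]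
  have h' := (Finset.card_le_card h).trans (Finset.card_biUnion_le_card_mul _ _ 27 fun A hA => by
    simp [hE A (Finset.mem_filter.1 hA).1])
  rw [mul_comm] at h'
  exact_mod_cast h'

variable [Fintype V]

/-- The ordered triples forming an edge. -/
def edgeTriples (E : Finset (Finset V)) : Finset (V × V × V) :=
  Finset.univ.filter fun t => EdgeRel E t.1 t.2.1 t.2.2

/-- The ordered pairs forming an edge together with `b`. -/
def linkPairs (E : Finset (Finset V)) (b : V) : Finset (V × V) :=
  Finset.univ.filter fun t => EdgeRel E b t.1 t.2

/-- The vertices forming an edge together with `a` and `b`. -/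
def pairLink (E : Finset (Finset V)) (a b : V) : Finset V :=
  Finset.univ.filter fun c => EdgeRel E a b c

theorem card_edgeTriples_le {E : Finset (Finset V)} (hE : ∀ A ∈ E, A.card = 3) :
    (edgeTriples E).card ≤ 27 * E.card := by
  have h : edgeTriples E ⊆ E.biUnion fun A => A ×ˢ A ×ˢ A := by
    rintro ⟨a, b, c⟩ ht
    exact Finset.mem_biUnion.2 ⟨{a, b, c}, (Finset.mem_filter.1 ht).2, by simp⟩
  rw [mul_comm]
  exact (Finset.card_le_card h).trans (Finset.card_biUnion_le_card_mul _ _ 27 fun A hA => by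
    simp [hE A hA])

theorem card_edgeTriples_eq_sum (E : Finset (Finset V)) :
    (edgeTriples E).card = ∑ b, (linkPairs E b).card := by
  simp only [edgeTriples, linkPairs, Finset.card_filter]
  rw [Fintype.sum_prod_type]

theorem card_pairLink_le {E : Finset (Finset V)} (hE : ∀ A ∈ E, A.card = 3) {s : ℕ}
    (hs : ∀ u v : V, u ≠ v → (E.filter fun A => u ∈ A ∧ v ∈ A).card ≤ s) (a b : V) :
    (pairLink E a b).card ≤ s := by
  rcases eq_or_ne a b with rfl | hab
  · have : pairLink E a a = ∅ :=
      Finset.filter_eq_empty_iff.2 fun c _ h => (ne_of_edgeRel hE h).1 rfl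
    simp [this]
  refine le_trans (Finset.card_le_card_of_injOn (fun c => {a, b, c}) ?_ ?_) (hs a b hab)
  · intro c hc
    have := (Finset.mem_filter.1 hc).2
    simpa using this
  · intro c hc c' hc' h
    replace hc := (Finset.mem_filter.1 hc).2
    replace hc' := (Finset.mem_filter.1 hc').2
    have h1 := ne_of_edgeRel hE hc
    have : c ∈ ({a, b, c'} : Finset V) := by
      rw [← show ({a, b, c} : Finset V) = {a, b, c'} from h]; simp
    simp only [Finset.mem_insert, Finset.mem_singleton] at this
    grind

/-- The 4-sets containing two edges which share two vertices. -/
def doubledSets (E : Finset (Finset V)) : Finset (Finset V) :=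
  (((edgeTriples E).sigma fun t => pairLink E t.1 t.2.1).image
    fun q => {q.1.1, q.1.2.1, q.1.2.2, q.2}).filter fun B => B.card = 4

/-- The 6-sets containing a triangle one of whose corners lies in `U`. -/
def triangleSets (E : Finset (Finset V)) (U : Finset V) : Finset (Finset V) :=
  ((((edgeTriples E).filter fun t => t.2.1 ∈ U).sigma fun t =>
      (linkPairs E t.2.1).sigma fun q => pairLink E t.1 q.1).image
    fun w => {w.1.1, w.1.2.1, w.2.1.1, w.1.2.2, w.2.1.2, w.2.2}).filter fun B => B.card = 6

theorem card_doubledSets_le {E : Finset (Finset V)} (hE : ∀ A ∈ E, A.card = 3) {s : ℕ}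
    (hs : ∀ u v : V, u ≠ v → (E.filter fun A => u ∈ A ∧ v ∈ A).card ≤ s) :
    (doubledSets E).card ≤ 27 * E.card * s := by
  refine (Finset.card_filter_le _ _).trans (Finset.card_image_le.trans ?_)
  rw [Finset.card_sigma]
  refine (Finset.sum_le_card_nsmul _ _ s fun t _ => card_pairLink_le hE hs _ _).trans ?_
  rw [smul_eq_mul]
  exact Nat.mul_le_mul_right _ (card_edgeTriples_le hE)

theorem card_triangleSets_le {E : Finset (Finset V)} (hE : ∀ A ∈ E, A.card = 3) {s : ℕ}
    (hs : ∀ u v : V, u ≠ v → (E.filter fun A => u ∈ A ∧ v ∈ A).card ≤ s) {U : Finset V} {D : ℕ}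
    (hU : ∀ b ∈ U, (linkPairs E b).card ≤ D) :
    (triangleSets E U).card ≤ 27 * E.card * (D * s) := by
  refine (Finset.card_filter_le _ _).trans (Finset.card_image_le.trans ?_)
  rw [Finset.card_sigma]
  refine (Finset.sum_le_card_nsmul _ _ (D * s) fun t ht => ?_).trans ?_
  · rw [Finset.card_sigma]
    refine (Finset.sum_le_card_nsmul _ _ s fun t _ => card_pairLink_le hE hs _ _).trans ?_
    rw [smul_eq_mul]
    exact Nat.mul_le_mul_right _ (hU _ (Finset.mem_filter.1 ht).2)
  rw [smul_eq_mul]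
  exact Nat.mul_le_mul_right _ ((Finset.card_filter_le _ _).trans (card_edgeTriples_le hE))

theorem isUncrowded_of_avoiding {E : Finset (Finset V)} (hE : ∀ A ∈ E, A.card = 3)
    {U S : Finset V} (hSU : S ⊆ U) (h2 : ∀ B ∈ doubledSets E, ¬B ⊆ S)
    (h3 : ∀ B ∈ triangleSets E U, ¬B ⊆ S) :
    IsUncrowded (EdgeRel (E.filter (· ⊆ S))) := by
  refine isUncrowded_edgeRel (fun A hA => hE A (Finset.mem_filter.1 hA).1) ?_ ?_
  · intro a b c c' h h'
    by_contra hcc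
    simp only [EdgeRel, Finset.mem_filter] at h h'
    have n1 := ne_of_edgeRel hE h.1
    have n2 := ne_of_edgeRel hE h'.1
    refine h2 {a, b, c, c'} ?_ ?_
    · refine Finset.mem_filter.2 ⟨Finset.mem_image.2 ⟨⟨(a, b, c), c'⟩, ?_, rfl⟩, ?_⟩
      · simp [edgeTriples, pairLink, h.1, h'.1, EdgeRel]
      · rw [Finset.card_insert_of_notMem, Finset.card_insert_of_notMem, Finset.card_pair hcc]
        all_goals simp only [Finset.mem_insert, Finset.mem_singleton, not_or]
        all_goals grind
    · have := h.2
      have := h'.2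
      grind
  · intro a b c x y z hx hy hz h6
    simp only [EdgeRel, Finset.mem_filter] at hx hy hz
    refine h3 {a, b, c, x, y, z} ?_ ?_
    · refine Finset.mem_filter.2
        ⟨Finset.mem_image.2 ⟨⟨(a, b, x), ⟨(c, y), z⟩⟩, ?_, rfl⟩, h6⟩
      have : b ∈ U := hSU (hx.2 (by simp))
      simp [edgeTriples, pairLink, linkPairs, hx.1, hy.1, hz.1, EdgeRel, this]
    · have := hx.2
      have := hy.2
      have := hz.2
      grind

/-- The independence number of a sparse subset with few edges. -/
theorem le_of_avoiding {E : Finset (Finset V)} (hE : ∀ A ∈ E, A.card = 3) {U R : Finset V}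
    (hRU : R ⊆ U) {K M T : ℝ} (hK : ∀ I ⊆ R, (∀ A ∈ E, ¬A ⊆ I) → (I.card : ℝ) ≤ K)
    (hM : 1 < M) (hT : 0 < T) (hTM : 4 * T * M ≤ 1) (hTlog : 2 * (T * M) ≤ Real.log M) :
    T / 2 * R.card ≤ K + T / 2 * ((doubledSets E).filter (· ⊆ R)).card +
      T / 2 * ((triangleSets E U).filter (· ⊆ R)).card +
      27 * T ^ 3 / Real.log M * (E.filter (· ⊆ R)).card := by
  obtain ⟨S, hSR, hS, hcard⟩ := exists_subset_avoiding (doubledSets E ∪ triangleSets E U)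
    (fun B hB => by
      rw [← Finset.card_pos]
      rcases Finset.mem_union.1 hB with h | h
      · rw [(Finset.mem_filter.1 h).2]; norm_num
      · rw [(Finset.mem_filter.1 h).2]; norm_num) R
  have hr := isUncrowded_of_avoiding hE (hSR.trans hRU)
    (fun B hB => hS B (Finset.mem_union_left _ hB)) (fun B hB => hS B (Finset.mem_union_right _ hB))
  have main := hr.le_of_forall_card_le (S := S) (K := K) (fun I hI hind => by
    refine hK I (hI.trans hSR) fun A hA hAI => ?_
    obtain ⟨a, b, c, -, -, -, rfl⟩ := Finset.card_eq_three.1 (hE A hA)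
    exact hind a (hAI (by simp)) b (hAI (by simp)) c (hAI (by simp))
      (Finset.mem_filter.2 ⟨hA, hAI.trans hI⟩)) hM hT hTM hTlog
  have hsum := sum_indic_edgeRel_le (E.filter (· ⊆ S))
    (fun A hA => hE A (Finset.mem_filter.1 hA).1) S
  have hcount : ((E.filter (· ⊆ S)).filter (· ⊆ S)).card ≤ (E.filter (· ⊆ R)).card :=
    Finset.card_le_card fun A hA => Finset.mem_filter.2
      ⟨(Finset.mem_filter.1 (Finset.mem_filter.1 hA).1).1, (Finset.mem_filter.1 hA).2.trans hSR⟩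
  have hcount' : (((E.filter (· ⊆ S)).filter (· ⊆ S)).card : ℝ) ≤ (E.filter (· ⊆ R)).card := by
    exact_mod_cast hcount
  have hlog : 0 < Real.log M := Real.log_pos hM
  have hunion : ((doubledSets E ∪ triangleSets E U).filter (· ⊆ R)).card ≤
      ((doubledSets E).filter (· ⊆ R)).card + ((triangleSets E U).filter (· ⊆ R)).card := by
    rw [Finset.filter_union]; exact Finset.card_union_le _ _
  have hcard' : (R.card : ℝ) ≤ S.card + (((doubledSets E).filter (· ⊆ R)).card +
      ((triangleSets E U).filter (· ⊆ R)).card) := by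
    exact_mod_cast hcard.trans (Nat.add_le_add_left hunion _)
  have h1 : T ^ 3 / Real.log M * (∑ a ∈ S, ∑ b ∈ S, ∑ c ∈ S,
      indic (EdgeRel (E.filter (· ⊆ S)) a b c)) ≤
      T ^ 3 / Real.log M * (27 * (E.filter (· ⊆ R)).card) :=
    mul_le_mul_of_nonneg_left (by linarith) (by positivity)
  have h2 := mul_le_mul_of_nonneg_left hcard' (by positivity : 0 ≤ T / 2)
  have h3 : T ^ 3 / Real.log M * (27 * (E.filter (· ⊆ R)).card) =
      27 * T ^ 3 / Real.log M * (E.filter (· ⊆ R)).card := by ring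
  linarith

/-- A lower bound for the number of independent sets from a random sparse subset. -/
theorem le_card_indep {E : Finset (Finset V)} (hE : ∀ A ∈ E, A.card = 3) {s : ℕ}
    (hs : ∀ u v : V, u ≠ v → (E.filter fun A => u ∈ A ∧ v ∈ A).card ≤ s) {U : Finset V} {D : ℕ}
    (hU : ∀ b ∈ U, (linkPairs E b).card ≤ D) {p M T k : ℝ} (hp : 0 < p) (hp1 : p ≤ 1)
    (hM : 1 < M) (hT : 0 < T) (hTM : 4 * T * M ≤ 1) (hTlog : 2 * (T * M) ≤ Real.log M)
    (hk : 0 ≤ k) :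
    T / 2 * (p * U.card) ≤
      k + Fintype.card V * ((Finset.univ.filter fun I : Finset V => ∀ A ∈ E, ¬A ⊆ I).card * p ^ k) +
      T / 2 * (27 * E.card * s * p ^ 4) + T / 2 * (27 * E.card * (D * s) * p ^ 6) +
      27 * T ^ 3 / Real.log M * (E.card * p ^ 3) := by
  set J := Finset.univ.filter fun I : Finset V => ∀ A ∈ E, ¬A ⊆ I with hJ
  set J' := J.filter fun I => k ≤ I.card with hJ'
  have hlog : 0 < Real.log M := Real.log_pos hM
  have main := subsetMean_mono (U := U) hp.le hp1 fun R hR => le_of_avoiding hE hR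
    (K := k + Fintype.card V * (J'.filter (· ⊆ R)).card) (fun I hIR hI => by
      by_cases hkI : k ≤ I.card
      · have h1 : I ∈ J'.filter (· ⊆ R) := by
          simpa [hJ', hJ, hIR, hkI] using hI
        have h2 : (1 : ℝ) ≤ (J'.filter (· ⊆ R)).card := by
          exact_mod_cast Finset.card_pos.2 ⟨I, h1⟩
        have h3 : (I.card : ℝ) ≤ Fintype.card V := by exact_mod_cast Finset.card_le_univ I
        have h4 : (0 : ℝ) ≤ Fintype.card V := Nat.cast_nonneg _
        nlinarith
      · have : (0 : ℝ) ≤ Fintype.card V * (J'.filter (· ⊆ R)).card := by positivity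
        linarith) hM hT hTM hTlog
  simp only [subsetMean_add, subsetMean_const_mul, subsetMean_const, subsetMean_card] at main
  have b1 : subsetMean p U (fun R => ((J'.filter (· ⊆ R)).card : ℝ)) ≤ J.card * p ^ k := by
    refine (subsetMean_card_filter_le J' (q := p ^ k) (fun I hI => ?_) (by positivity)).trans ?_
    · rw [← Real.rpow_natCast]
      exact Real.rpow_le_rpow_of_exponent_ge hp hp1 (Finset.mem_filter.1 hI).2
    · exact mul_le_mul_of_nonneg_right
        (by exact_mod_cast Finset.card_le_card (Finset.filter_subset _ _)) (by positivity)
  have b2 : subsetMean p U (fun R => (((doubledSets E).filter (· ⊆ R)).card : ℝ)) ≤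
      27 * E.card * s * p ^ 4 := by
    refine (subsetMean_card_filter_le _ (q := p ^ 4) (fun B hB => ?_) (by positivity)).trans ?_
    · rw [(Finset.mem_filter.1 hB).2]
    · exact mul_le_mul_of_nonneg_right
        (by exact_mod_cast card_doubledSets_le hE hs) (by positivity)
  have b3 : subsetMean p U (fun R => (((triangleSets E U).filter (· ⊆ R)).card : ℝ)) ≤
      27 * E.card * (D * s) * p ^ 6 := by
    refine (subsetMean_card_filter_le _ (q := p ^ 6) (fun B hB => ?_) (by positivity)).trans ?_
    · rw [(Finset.mem_filter.1 hB).2]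
    · exact mul_le_mul_of_nonneg_right
        (by exact_mod_cast card_triangleSets_le hE hs hU) (by positivity)
  have b4 : subsetMean p U (fun R => ((E.filter (· ⊆ R)).card : ℝ)) ≤ E.card * p ^ 3 :=
    subsetMean_card_filter_le _ (fun B hB => by rw [hE B hB]) (by positivity)
  have c1 := mul_le_mul_of_nonneg_left b1 (Nat.cast_nonneg (α := ℝ) (Fintype.card V))
  have c2 := mul_le_mul_of_nonneg_left b2 (by positivity : 0 ≤ T / 2)
  have c3 := mul_le_mul_of_nonneg_left b3 (by positivity : 0 ≤ T / 2)
  have c4 := mul_le_mul_of_nonneg_left b4 (by positivity : 0 ≤ 27 * T ^ 3 / Real.log M)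
  linarith

/-- At least half of the vertices have few link pairs. -/
theorem card_le_two_mul_card_filter {E : Finset (Finset V)} (hE : ∀ A ∈ E, A.card = 3) {D : ℕ}
    (hD : 54 * E.card < (D + 1) * Fintype.card V) :
    Fintype.card V ≤ 2 * (Finset.univ.filter fun b => (linkPairs E b).card ≤ D).card := by
  by_contra! hlt
  have h1 := Finset.card_filter_add_card_filter_not (s := (Finset.univ : Finset V))
    (fun b => (linkPairs E b).card ≤ D)
  rw [Finset.card_univ] at h1
  have h2 : ∑ b ∈ Finset.univ.filter (fun b => ¬(linkPairs E b).card ≤ D), (D + 1) ≤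
      ∑ b, (linkPairs E b).card :=
    (Finset.sum_le_sum fun b hb => by
      have := (Finset.mem_filter.1 hb).2; omega).trans
      (Finset.sum_le_sum_of_subset (Finset.filter_subset _ _))
  rw [← card_edgeTriples_eq_sum, Finset.sum_const, smul_eq_mul] at h2
  have h3 := card_edgeTriples_le hE
  nlinarith

/-- The number of edges is at most quadratic in the number of vertices. -/
theorem card_edges_le {E : Finset (Finset V)} (hE : ∀ A ∈ E, A.card = 3) {s : ℕ}
    (hs : ∀ u v : V, u ≠ v → (E.filter fun A => u ∈ A ∧ v ∈ A).card ≤ s) :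
    E.card ≤ Fintype.card V * Fintype.card V * s := by
  have h : E ⊆ ((Finset.univ : Finset (V × V)).filter fun q => q.1 ≠ q.2).biUnion
      fun q => E.filter fun A => q.1 ∈ A ∧ q.2 ∈ A := by
    intro A hA
    obtain ⟨a, b, c, hab, -, -, rfl⟩ := Finset.card_eq_three.1 (hE A hA)
    exact Finset.mem_biUnion.2 ⟨(a, b), by simp [hab], by simp [hA]⟩
  refine (Finset.card_le_card h).trans ((Finset.card_biUnion_le_card_mul _ _ s fun q hq =>
    hs _ _ (Finset.mem_filter.1 hq).2).trans (Nat.mul_le_mul_right _ ?_))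
  refine (Finset.card_filter_le _ _).trans ?_
  simp

/-- A large independent set in a hypergraph of moderate average degree. -/
theorem exists_indep_card_ge {E : Finset (Finset V)} (hE : ∀ A ∈ E, A.card = 3) {p : ℝ}
    (hp : 0 ≤ p) (hp1 : p ≤ 1) :
    ∃ I : Finset V, (∀ A ∈ E, ¬A ⊆ I) ∧ p * Fintype.card V - E.card * p ^ 3 ≤ I.card := by
  by_contra! hcon
  obtain ⟨I₀, hmem, hI₀⟩ := Finset.exists_max_image
    (Finset.univ.filter fun I : Finset V => ∀ A ∈ E, ¬A ⊆ I) Finset.card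
    ⟨∅, by
      simp only [Finset.mem_filter, Finset.mem_univ, true_and, Finset.subset_empty]
      rintro A hA rfl
      simpa using hE _ hA⟩
  replace hmem := (Finset.mem_filter.1 hmem).2
  have key := subsetMean_mono (U := (Finset.univ : Finset V)) hp hp1
    (f := fun R => (R.card : ℝ)) (g := fun R => I₀.card + (E.filter (· ⊆ R)).card) fun R _ => by
      obtain ⟨S, -, hS, hc⟩ := exists_subset_avoiding E
        (fun B hB => by rw [← Finset.card_pos, hE B hB]; norm_num) R
      have := hI₀ S (by simpa using hS)
      exact_mod_cast hc.trans (Nat.add_le_add_right this _)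
  rw [subsetMean_card, subsetMean_add, subsetMean_const] at key
  have b4 : subsetMean p Finset.univ (fun R => ((E.filter (· ⊆ R)).card : ℝ)) ≤
      E.card * p ^ 3 :=
    subsetMean_card_filter_le _ (fun B hB => by rw [hE B hB]) (by positivity)
  have := hcon I₀ hmem
  rw [Finset.card_univ] at key
  linarith

theorem two_pow_card_le_card_indep {E : Finset (Finset V)} {I : Finset V}
    (hI : ∀ A ∈ E, ¬A ⊆ I) :
    2 ^ I.card ≤ (Finset.univ.filter fun I : Finset V => ∀ A ∈ E, ¬A ⊆ I).card := by
  rw [← Finset.card_powerset]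
  refine Finset.card_le_card fun J hJ => ?_
  rw [Finset.mem_powerset] at hJ
  simpa using fun A hA h => hI A hA (h.trans hJ)

theorem exp_le_card_indep {E : Finset (Finset V)} (hE : ∀ A ∈ E, A.card = 3) {s : ℕ}
    (hs1 : 1 ≤ s) (hs : ∀ u v : V, u ≠ v → (E.filter fun A => u ∈ A ∧ v ∈ A).card ≤ s) {y : ℝ}
    (hV : 0 < Fintype.card V) (hE' : (E.card : ℝ) = Fintype.card V * y ^ 32 / 3) (hy : 1 ≤ y)
    (hys : 1368 * s ≤ y ^ 6) :
    Real.exp (Fintype.card V * Real.log y * √(Real.log y) / (192 * y ^ 16)) ≤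
      (Finset.univ.filter fun I : Finset V => ∀ A ∈ E, ¬A ⊆ I).card := by
  have hs1' : (1 : ℝ) ≤ s := by exact_mod_cast hs1
  have hy3 : 3 ≤ y := by
    by_contra! h
    have : y ^ 6 < 3 ^ 6 := pow_lt_pow_left₀ h (by linarith) (by norm_num)
    linarith
  have hy0 : 0 < y := by linarith
  have hn : (0 : ℝ) < Fintype.card V := by exact_mod_cast hV
  have hlam1 : 1 ≤ Real.log y := by
    rw [Real.le_log_iff_exp_le hy0]
    linarith [Real.exp_one_lt_d9]
  have hlamy : Real.log y ≤ y := (Real.log_le_sub_one_of_pos hy0).trans (by linarith)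
  have hw1 : 1 ≤ √(Real.log y) := Real.one_le_sqrt.2 hlam1
  have hww : √(Real.log y) ^ 2 = Real.log y := Real.sq_sqrt (by linarith)
  set lam := Real.log y with hlam
  set w := √lam
  have hwlam : w ≤ lam := by nlinarith
  have hed : (E.card : ℝ) ≤ Fintype.card V * Fintype.card V * s := by
    exact_mod_cast card_edges_le hE hs
  set D := ⌊18 * y ^ 32⌋₊
  have hD1 : (D : ℝ) ≤ 18 * y ^ 32 := Nat.floor_le (by positivity)
  have hD2 : 18 * y ^ 32 < D + 1 := Nat.lt_floor_add_one _
  have hU := card_le_two_mul_card_filter hE (D := D) (by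
    have : (54 : ℝ) * E.card < (D + 1) * Fintype.card V := by rw [hE']; nlinarith
    exact_mod_cast this)
  set U := Finset.univ.filter fun b => (linkPairs E b).card ≤ D
  have hU' : (Fintype.card V : ℝ) ≤ 2 * (U.card : ℝ) := by exact_mod_cast hU
  set n : ℝ := ((Fintype.card V : ℕ) : ℝ)
  set J := Finset.univ.filter fun I : Finset V => ∀ A ∈ E, ¬A ⊆ I
  set e : ℝ := ((E.card : ℕ) : ℝ)
  set p := (y ^ 14)⁻¹ with hp
  set T := w / (12 * y ^ 2) with hT
  have hp0 : 0 < p := by positivity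
  have hT0 : 0 < T := by positivity
  set k := n * w / (192 * y ^ 16) with hk
  have hk0 : 0 < k := by positivity
  have hTy : T * y = w / (12 * y) := by rw [hT]; field_simp
  have hy6 : y ^ 6 ≤ y ^ 16 := pow_le_pow_right₀ hy (by norm_num)
  have hy10 : y ^ 6 ≤ y ^ 10 := pow_le_pow_right₀ hy (by norm_num)
  have main := le_card_indep (s := s) (D := D) (U := U) (p := p) (M := y) (T := T) (k := k)
    hE hs (fun b hb => (Finset.mem_filter.1 hb).2) hp0
    (inv_le_one_of_one_le₀ (one_le_pow₀ hy)) (by linarith) hT0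
    (by
      rw [mul_assoc, hTy, ← mul_div_assoc, div_le_one (by positivity)]; linarith)
    (by
      rw [hTy, ← mul_div_assoc, div_le_iff₀ (by positivity)]; nlinarith) hk0.le
  change T / 2 * (p * U.card) ≤ k + n * (J.card * p ^ k) + T / 2 * (27 * e * s * p ^ 4) +
    T / 2 * (27 * e * (D * s) * p ^ 6) + 27 * T ^ 3 / lam * (e * p ^ 3) at main
  have m1 : 27 * e * s * p ^ 4 = p * n * (9 * s / y ^ 10) := by
    rw [hE', hp]; field_simp; norm_num
  have m2 : 27 * e * (D * s) * p ^ 6 ≤ p * n * (162 * s / y ^ 6) := by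
    calc _ ≤ 27 * e * (18 * y ^ 32 * s) * p ^ 6 := by gcongr
      _ = p * n * (162 * s / y ^ 6) := by rw [hE', hp]; field_simp; norm_num
  have m3 : 27 * T ^ 3 / lam * (e * p ^ 3) = T * p * n / 16 := by
    rw [← hww, hE', hp, hT]; field_simp; norm_num
  have m4 : 9 * s / y ^ 10 ≤ 9 / 1368 := by
    rw [div_le_div_iff₀ (by positivity) (by norm_num)]; linarith
  have m5 : 162 * s / y ^ 6 ≤ 162 / 1368 := by
    rw [div_le_div_iff₀ (by positivity) (by norm_num)]; linarith
  have m6 : k = T * p * n / 16 := by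
    rw [hk, hp, hT]; field_simp; norm_num
  have hpn : 0 ≤ T / 2 * (p * n) := by positivity
  have m7 : k ≤ n * (J.card * p ^ k) := by
    have g1 := mul_le_mul_of_nonneg_left m2 (by positivity : 0 ≤ T / 2)
    have g2 := mul_le_mul_of_nonneg_left m4 hpn
    have g3 := mul_le_mul_of_nonneg_left m5 hpn
    have g4 := mul_le_mul_of_nonneg_left hU' (by positivity : 0 ≤ T / 2 * p)
    rw [m1, m3] at main
    rw [m6] at main ⊢
    linarith
  have hk2 : 2 ≤ k := by
    have h1 : n * y ^ 32 ≤ n * (3 * n * s) := by rw [hE'] at hed; linarith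
    have h2 : y ^ 32 ≤ 3 * n * s := le_of_mul_le_mul_left h1 hn
    rw [hk, le_div_iff₀ (by positivity)]
    have h3 : y ^ 16 * (1368 * s) ≤ 3 * n * s := by
      calc y ^ 16 * (1368 * s) ≤ y ^ 16 * y ^ 16 := by gcongr; linarith
        _ = y ^ 32 := by ring
        _ ≤ _ := h2
    have h4 : y ^ 16 * 1368 ≤ 3 * n :=
      le_of_mul_le_mul_right (by linarith) (by linarith : (0 : ℝ) < s)
    nlinarith
  have hpk : p ^ k = (y ^ (14 * k))⁻¹ := by
    rw [hp, Real.inv_rpow (by positivity), ← Real.rpow_natCast, ← Real.rpow_mul hy0.le]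
    norm_num
  have hexp : Real.exp (n * lam * w / (192 * y ^ 16)) = y ^ k := by
    rw [Real.rpow_def_of_pos hy0, hk]
    congr 1
    rw [← hlam]; ring
  rw [hexp]
  have q1 : w / (192 * y ^ 16) * y ^ (14 * k) ≤ J.card := by
    have : n * (w / (192 * y ^ 16) * y ^ (14 * k)) ≤ n * J.card := by
      rw [hpk] at m7
      have hpos : 0 < y ^ (14 * k) := Real.rpow_pos_of_pos hy0 _
      have := mul_le_mul_of_nonneg_right m7 hpos.le
      calc _ = k * y ^ (14 * k) := by rw [hk]; ring
        _ ≤ _ := this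
        _ = n * J.card := by field_simp
    exact le_of_mul_le_mul_left this hn
  have q2 : 192 * y ^ 16 ≤ y ^ (13 * k) := by
    calc 192 * y ^ 16 ≤ y ^ 10 * y ^ 16 := by gcongr; linarith
      _ = y ^ ((26 : ℕ) : ℝ) := by rw [Real.rpow_natCast]; ring
      _ ≤ y ^ (13 * k) := Real.rpow_le_rpow_of_exponent_le hy (by push_cast; linarith)
  refine le_trans ?_ q1
  have q3 : y ^ (14 * k) = y ^ (13 * k) * y ^ k := by
    rw [← Real.rpow_add hy0]; ring_nf
  have hyk : 0 < y ^ k := Real.rpow_pos_of_pos hy0 _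
  rw [q3, div_mul_eq_mul_div, le_div_iff₀ (by positivity)]
  calc y ^ k * (192 * y ^ 16) ≤ y ^ k * y ^ (13 * k) := by gcongr
    _ = 1 * (y ^ (13 * k) * y ^ k) := by ring
    _ ≤ w * (y ^ (13 * k) * y ^ k) := by gcongr

theorem two_rpow_le_card_indep {E : Finset (Finset V)} (hE : ∀ A ∈ E, A.card = 3) {y : ℝ}
    (hE' : (E.card : ℝ) = Fintype.card V * y ^ 32 / 3) (hy : 1 ≤ y) :
    (2 : ℝ) ^ (Fintype.card V / (2 * y ^ 16)) ≤
      (Finset.univ.filter fun I : Finset V => ∀ A ∈ E, ¬A ⊆ I).card := by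
  have hy0 : 0 < y := by linarith
  obtain ⟨I, hI, hcard⟩ := exists_indep_card_ge hE (p := (y ^ 16)⁻¹) (by positivity)
    (inv_le_one_of_one_le₀ (one_le_pow₀ hy))
  have h1 : (2 : ℝ) ^ (I.card : ℝ) ≤
      (Finset.univ.filter fun I : Finset V => ∀ A ∈ E, ¬A ⊆ I).card := by
    rw [Real.rpow_natCast]
    exact_mod_cast two_pow_card_le_card_indep hI
  refine le_trans (Real.rpow_le_rpow_of_exponent_le one_le_two ?_) h1
  refine le_trans ?_ hcard
  have e1 : (y ^ 16)⁻¹ * Fintype.card V - E.card * ((y ^ 16)⁻¹) ^ 3 =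
      2 / 3 * (Fintype.card V / y ^ 16) := by
    rw [hE']; field_simp; norm_num
  have e2 : (Fintype.card V : ℝ) / (2 * y ^ 16) = 1 / 2 * (Fintype.card V / y ^ 16) := by ring
  have e3 : 0 ≤ (Fintype.card V : ℝ) / y ^ 16 := by positivity
  rw [e1, e2]; linarith

end Hypergraph

theorem rpow_three_halves_le {t : ℝ} (ht : 0 ≤ t) :
    (32 * t) ^ ((3 : ℝ) / 2) ≤ 182 * (t * √t) := by
  have h1 : (32 * t) ^ ((3 : ℝ) / 2) = (32 * t) * (√32 * √t) := by
    rw [← Real.sqrt_mul (by norm_num), Real.sqrt_eq_rpow]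
    nth_rw 2 [← Real.rpow_one (32 * t)]
    rw [← Real.rpow_add_of_nonneg (by positivity) (by norm_num) (by norm_num)]
    norm_num
  have h2 : √32 ≤ 182 / 32 := by
    rw [Real.sqrt_le_left (by norm_num)]; norm_num
  rw [h1]
  have h3 : 0 ≤ t * √t := by positivity
  nlinarith

/-- For every `s ≥ 1` there is `c > 0` such that every 3-uniform hypergraph on `n` vertices
with `m` edges, average degree `d = 3m/n ≥ 2`, and maximum codegree at most `s`, has at
least `2^(c · n · (log d)^(3/2) / d^(1/2))` independent sets. -/
theorem stmt18 (s : ℕ) (hs : 1 ≤ s) :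
    ∃ c : ℝ, 0 < c ∧
      ∀ (V : Type) [Fintype V] [DecidableEq V] (E : Finset (Finset V)),
        (∀ A ∈ E, A.card = 3) →
        ∀ d : ℝ, d = 3 * E.card / Fintype.card V → 2 ≤ d →
        (∀ u v : V, u ≠ v → (E.filter fun A => u ∈ A ∧ v ∈ A).card ≤ s) →
        (2 : ℝ) ^ (c * Fintype.card V * Real.log d ^ ((3 : ℝ) / 2) / d ^ ((1 : ℝ) / 2)) ≤
          Nat.card {I : Finset V // ∀ A ∈ E, ¬A ⊆ I} := by
  have hs' : (1 : ℝ) ≤ s := by exact_mod_cast hs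
  refine ⟨1 / (40000 * (1368 * s) ^ 2), by positivity, ?_⟩
  intro V _ _ E hE d hd hd2 hcod
  have hV : 0 < Fintype.card V := by
    by_contra! h
    have : Fintype.card V = 0 := by omega
    rw [this] at hd
    simp at hd
    linarith
  have hn : (0 : ℝ) < Fintype.card V := by exact_mod_cast hV
  have hd0 : 0 < d := by linarith
  obtain ⟨y, hy1, hyd⟩ : ∃ y : ℝ, 1 ≤ y ∧ d = y ^ 32 := by
    refine ⟨d ^ ((1 : ℝ) / 32), Real.one_le_rpow (by linarith) (by norm_num), ?_⟩
    rw [← Real.rpow_natCast, ← Real.rpow_mul hd0.le]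
    norm_num
  have hy0 : 0 < y := by linarith
  have hE' : (E.card : ℝ) = Fintype.card V * y ^ 32 / 3 := by
    rw [← hyd, hd]; field_simp
  have hsqrt : d ^ ((1 : ℝ) / 2) = y ^ 16 := by
    rw [← Real.sqrt_eq_rpow, hyd, show y ^ 32 = (y ^ 16) ^ 2 by ring,
      Real.sqrt_sq (by positivity)]
  have hlog : Real.log d = 32 * Real.log y := by rw [hyd, Real.log_pow]; norm_num
  have hlam0 : 0 ≤ Real.log y := Real.log_nonneg hy1
  have hcount : Nat.card {I : Finset V // ∀ A ∈ E, ¬A ⊆ I} =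
      (Finset.univ.filter fun I : Finset V => ∀ A ∈ E, ¬A ⊆ I).card := by
    rw [Nat.card_eq_fintype_card, Fintype.card_subtype]
  rw [hcount, hsqrt, hlog]
  have hbound := rpow_three_halves_le hlam0
  have hw2 : √(Real.log y) ^ 2 = Real.log y := Real.sq_sqrt hlam0
  have hw0 := Real.sqrt_nonneg (Real.log y)
  set Z := (32 * Real.log y) ^ ((3 : ℝ) / 2)
  set G : ℝ := (1368 * s) ^ 2 with hG
  have hG1 : 1 ≤ G := by rw [hG]; exact one_le_pow₀ (by linarith)
  have hZ0 : 0 ≤ Z := by positivity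
  rcases le_or_gt (1368 * (s : ℝ)) (y ^ 6) with hlarge | hsmall
  · refine le_trans ?_ (exp_le_card_indep hE hs hcod hV hE' hy1 hlarge)
    rw [Real.rpow_def_of_pos two_pos, Real.exp_le_exp]
    have hlog2 : Real.log 2 ≤ 1 := by linarith [Real.log_two_lt_d9]
    have hx : 0 ≤ 1 / (40000 * G) * Fintype.card V * Z / y ^ 16 := by positivity
    have hc : 1 / (40000 * G) ≤ 1 / 40000 :=
      one_div_le_one_div_of_le (by norm_num) (by linarith)
    calc _ ≤ 1 * (1 / (40000 * G) * Fintype.card V * Z / y ^ 16) :=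
          mul_le_mul_of_nonneg_right hlog2 hx
      _ ≤ 1 / 40000 * Fintype.card V * (182 * (Real.log y * √(Real.log y))) / y ^ 16 := by
          rw [one_mul]; gcongr
      _ = 34944 / 40000 * (Fintype.card V * Real.log y * √(Real.log y) / (192 * y ^ 16)) := by
          field_simp; ring
      _ ≤ _ := by
          have : 0 ≤ Fintype.card V * Real.log y * √(Real.log y) / (192 * y ^ 16) := by
            positivity
          linarith
  · refine le_trans (Real.rpow_le_rpow_of_exponent_le one_le_two ?_)
      (two_rpow_le_card_indep hE hE' hy1)
    have hyy : y ≤ y ^ 6 := le_self_pow₀ hy1 (by norm_num)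
    have hlam : Real.log y ≤ 1368 * s := by
      have := Real.log_le_sub_one_of_pos hy0
      linarith
    have hw : √(Real.log y) ≤ 1368 * s := by nlinarith
    have hlw : Real.log y * √(Real.log y) ≤ G := by
      rw [hG, sq]; exact mul_le_mul hlam hw hw0 (by linarith)
    calc _ ≤ 1 / (40000 * G) * Fintype.card V * (182 * G) / y ^ 16 := by
          gcongr; linarith
      _ = 364 / 40000 * (Fintype.card V / (2 * y ^ 16)) := by field_simp; norm_num
      _ ≤ _ := by
          have : 0 ≤ (Fintype.card V : ℝ) / (2 * y ^ 16) := by positivity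
          linarith
end
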